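/- arXiv:2301.02337 — 4 statements merged into one kernel-verified Lean document; each statement's English description precedes it below -/
import Mathlib

section
/- Let σ = {σ_i | i ∈ I} be a partition of the set of all primes, G a finite σ-full group of Sylow type with a complete Hall σ-set 𝓗 = {H_1, …, H_t} such that each H_i is a nilpotent σ_i-subgroup, and E a normal subgroup of G with G/E supersoluble. Suppose that for every σ_i ∈ σ(E), whenever H_i ∩ E is non-cyclic, every maximal subgroup of H_i ∩ E has a σ_i-sylowizer in G that is c-permutable in G with every member of 𝓗. Then G is supersoluble. -/
open Pointwise

/-- `n` is a `σ`-number: every prime divisor of `n` lies in `σ`. -/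
def IsSigmaNumber (σ : Set ℕ) (n : ℕ) : Prop :=
  ∀ p : ℕ, p.Prime → p ∣ n → p ∈ σ

/-- `H` is a Hall `σ`-subgroup of `S` (both viewed as subgroups of an ambient group `G`):
`H ≤ S`, `|H|` is a `σ`-number, and no prime in `σ` divides the index `|S : H|`. -/
def IsHallSigmaIn {G : Type*} [Group G] (σ : Set ℕ) (H S : Subgroup G) : Prop :=
  H ≤ S ∧ IsSigmaNumber σ (Nat.card H) ∧
    ∀ p : ℕ, p.Prime → p ∈ σ → ¬ p ∣ H.relIndex S

/-- `S` is a `σ`-sylowizer of `R` in `X` (all subgroups of an ambient group `G`):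
`S ≤ X`, `R` is a Hall `σ`-subgroup of `S`, and `S` is maximal among subgroups of `X`
having `R` as a Hall `σ`-subgroup. -/
def IsSylowizerIn {G : Type*} [Group G] (σ : Set ℕ) (X R S : Subgroup G) : Prop :=
  S ≤ X ∧ IsHallSigmaIn σ R S ∧
    ∀ S' : Subgroup G, S' ≤ X → IsHallSigmaIn σ R S' → S ≤ S' → S' = S

/-- The conjugate `xBx⁻¹` of a subgroup. -/
def conjSubgroup {G : Type*} [Group G] (x : G) (B : Subgroup G) : Subgroup G :=
  B.map (MulAut.conj x).toMonoidHom

/-- Two subgroups `A`, `B` of `G` are conditionally permutable in `G`: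
there is `x ∈ G` with `A · Bˣ = Bˣ · A` (as set products), where `Bˣ = x⁻¹Bx`. -/
def CPermutable {G : Type*} [Group G] (A B : Subgroup G) : Prop :=
  ∃ x : G, (A : Set G) * (conjSubgroup x⁻¹ B : Set G) = (conjSubgroup x⁻¹ B : Set G) * (A : Set G)

/-- `σ : I → Set ℕ` is a partition of the set of all primes into pairwise
disjoint nonempty sets of primes. -/
def IsPrimePartition {I : Type*} (σ : I → Set ℕ) : Prop :=
  (∀ i, (σ i).Nonempty) ∧ (∀ i, ∀ p ∈ σ i, p.Prime) ∧
    (∀ p : ℕ, p.Prime → ∃ i, p ∈ σ i) ∧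
    (∀ i j, i ≠ j → Disjoint (σ i) (σ j))

/-- `σ i ∈ σ(G)`, i.e. `σ i` meets the set of prime divisors of `|G|`. -/
def SigmaMem {I : Type*} (σ : I → Set ℕ) (G : Type*) [Group G] (i : I) : Prop :=
  ∃ p ∈ σ i, p ∣ Nat.card G

/-- `G` is `σ`-full: it has a Hall `σ i`-subgroup for every `σ i ∈ σ(G)`. -/
def SigmaFull {I : Type*} (σ : I → Set ℕ) (G : Type*) [Group G] : Prop :=
  ∀ i, SigmaMem σ G i → ∃ H : Subgroup G, IsHallSigmaIn (σ i) H ⊤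

/-- `G` is a `σ`-full group of Sylow type: for each `σ i ∈ σ(G)` there is a
Hall `σ i`-subgroup `H` such that every `σ i`-subgroup of `G` lies in some
`G`-conjugate of `H`. -/
def SigmaFullSylowType {I : Type*} (σ : I → Set ℕ) (G : Type*) [Group G] : Prop :=
  ∀ i, SigmaMem σ G i → ∃ H : Subgroup G, IsHallSigmaIn (σ i) H ⊤ ∧
    ∀ R : Subgroup G, IsSigmaNumber (σ i) (Nat.card R) → ∃ x : G, R ≤ conjSubgroup x H

/-- `O^σ(G)`: the intersection of all normal subgroups of `G` whose index is a `σ`-number. -/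
def sigmaResidual (σ : Set ℕ) (G : Type*) [Group G] : Subgroup G :=
  sInf {N : Subgroup G | N.Normal ∧ IsSigmaNumber σ N.index}

/-- `G` is supersoluble: there is a chain `⊥ = c 0 ≤ c 1 ≤ ⋯ ≤ c n = ⊤` of
subgroups, each normal in `G`, with each successive quotient cyclic (expressed by
saying the next term is generated by the previous one together with one element). -/
def IsSupersoluble (G : Type*) [Group G] : Prop :=
  ∃ (n : ℕ) (c : Fin (n + 1) → Subgroup G),
    c 0 = ⊥ ∧ c (Fin.last n) = ⊤ ∧ (∀ k, (c k).Normal) ∧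
      (∀ k : Fin n, c k.castSucc ≤ c k.succ) ∧
      (∀ k : Fin n, ∃ g ∈ c k.succ, c k.castSucc ⊔ Subgroup.zpowers g = c k.succ)



open scoped commutatorElement


theorem relIndex_map_subtype' {G : Type*} [Group G] (K : Subgroup G) (W : Subgroup K) :
    (W.map K.subtype).relIndex K = W.index := by
  rw [Subgroup.relIndex, Subgroup.subgroupOf,
    Subgroup.comap_map_eq_self_of_injective K.subtype_injective]

theorem exists_index_p_ge {P : Type*} [Group P] [Finite P] {p : ℕ} [hp : Fact p.Prime]
    (hP : IsPGroup p P) (W : Subgroup P) (hW : W ≠ ⊤) : ∃ W1 : Subgroup P, W ≤ W1 ∧ W1.index = p := by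
  obtain ⟨n, hn⟩ := IsPGroup.iff_card.mp hP
  obtain ⟨m, hm⟩ := IsPGroup.iff_card.mp (hP.to_subgroup W)
  have h1 : m < n := by
    by_contra h
    apply hW
    apply Subgroup.eq_top_of_le_card
    rw [hn, hm]
    exact Nat.pow_le_pow_right hp.out.pos (by omega)
  obtain ⟨K, hK, hWK⟩ := Sylow.exists_subgroup_card_pow_prime_le (G := P) (n := m) (m := n - 1) p
    (by rw [hn]; exact pow_dvd_pow _ (by omega)) W hm (by omega)
  refine ⟨K, hWK, ?_⟩
  have := K.card_mul_index
  rw [hK, hn] at this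
  have h2 : p ^ n = p ^ (n-1) * p := by rw [← pow_succ]; congr 1; omega
  rw [h2] at this
  exact Nat.eq_of_mul_eq_mul_left (pow_pos hp.out.pos _) this

theorem commutator_ne_self {P : Type*} [Group P] [Group.IsNilpotent P] (D : Subgroup P)
    (h : D ≤ ⁅D, (⊤ : Subgroup P)⁆) : D = ⊥ := by
  obtain ⟨n, hn⟩ := Subgroup.nilpotent_iff_lowerCentralSeries.mp ‹Group.IsNilpotent P›
  have : ∀ n, D ≤ Subgroup.lowerCentralSeries (⊤ : Subgroup P) n := by
    intro n
    induction n with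
    | zero => simp
    | succ k ih =>
      refine h.trans ?_
      rw [Subgroup.lowerCentralSeries_succ]
      exact Subgroup.commutator_mono ih le_rfl
  exact le_bot_iff.mp (hn ▸ this n)

theorem tate_core {E : Type*} [Group E] [Finite E] {p : ℕ} [hp : Fact p.Prime] (P : Sylow p E)
    (K : Subgroup E) [K.Normal] (hK : ∃ n, K.index = p ^ n)
    (hmin : ∀ K' : Subgroup E, K'.Normal → (∃ n, K'.index = p ^ n) → K ≤ K')
    (hΦ : ∀ W : Subgroup P, W ⊔ K.subgroupOf P = ⊤ → W = ⊤) : K.subgroupOf P = ⊥ := by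
  have hPp : IsPGroup p P := P.isPGroup'
  have : Group.IsNilpotent P := hPp.isNilpotent
  set D : Subgroup P := K.subgroupOf P with hD
  apply commutator_ne_self
  set D1 : Subgroup P := ⁅D, (⊤ : Subgroup P)⁆ with hD1
  have : D1.Normal := inferInstance
  have hD1D : D1 ≤ D := Subgroup.commutator_le_left _ _
  let b : (P ⧸ D1) →* (E ⧸ K) := QuotientGroup.lift D1 ((QuotientGroup.mk' K).comp (P : Subgroup E).subtype)
    (by
      intro x hx
      have := hD1D hx
      simpa [hD, Subgroup.mem_subgroupOf] using this)
  have hb : ∀ x : P, b (QuotientGroup.mk x) = QuotientGroup.mk (x : E) := fun x => rfl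
  have hker : ∀ u, u ∈ b.ker ↔ ∃ d ∈ D, QuotientGroup.mk d = u := by
    intro u
    obtain ⟨x, rfl⟩ := QuotientGroup.mk_surjective u
    rw [MonoidHom.mem_ker, hb]
    constructor
    · intro h
      exact ⟨x, by simpa [hD, Subgroup.mem_subgroupOf] using h, rfl⟩
    · rintro ⟨d, hd, hdx⟩
      rw [← hb, ← hdx, hb]
      simpa [hD, Subgroup.mem_subgroupOf] using hd
  have hcen : ∀ u ∈ b.ker, ∀ v, u * v = v * u := by
    intro u hu v
    obtain ⟨d, hd, rfl⟩ := (hker u).1 hu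
    obtain ⟨y, rfl⟩ := QuotientGroup.mk_surjective v
    rw [← QuotientGroup.mk_mul, ← QuotientGroup.mk_mul, eq_comm, QuotientGroup.eq]
    have h3 : (y * d)⁻¹ * (d * y) = ⁅d⁻¹, y⁻¹⁆ := by
      simp [commutatorElement_def, mul_assoc]
    rw [h3]
    exact Subgroup.commutator_mem_commutator (D.inv_mem hd) (Subgroup.mem_top _)
  let _ : CommGroup b.ker := { (inferInstance : Group b.ker) with mul_comm := fun x y => Subtype.ext (hcen x x.2 y) }
  have hbsurj : Function.Surjective b := by
    intro u
    obtain ⟨x, rfl⟩ := QuotientGroup.mk_surjective u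
    have hcop : ((P : Subgroup E) ⊔ K) = ⊤ := by
      rw [← Subgroup.index_eq_one]
      obtain ⟨n, hn⟩ := hK
      have h1 : ((P : Subgroup E) ⊔ K).index ∣ p ^ n := hn ▸ Subgroup.index_dvd_of_le le_sup_right
      have h2 : ((P : Subgroup E) ⊔ K).index ∣ (P : Subgroup E).index := Subgroup.index_dvd_of_le le_sup_left
      have h3 : Nat.Coprime (P : Subgroup E).index (p ^ n) :=
        Nat.Coprime.pow_right _ (((Nat.Prime.coprime_iff_not_dvd hp.out).2 P.not_dvd_index).symm)
      exact Nat.eq_one_of_dvd_coprimes h3 h2 h1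
    have hx : x ∈ ((P : Subgroup E) ⊔ K) := hcop ▸ Subgroup.mem_top x
    obtain ⟨y, hy, k, hk, rfl⟩ := Subgroup.mem_sup_of_normal_right.1 hx
    refine ⟨QuotientGroup.mk ⟨y, hy⟩, ?_⟩
    rw [hb, QuotientGroup.eq]
    simpa using hk
  let X : Subgroup (E × (P ⧸ D1)) := MonoidHom.eqLocus
    ((QuotientGroup.mk' K).comp (MonoidHom.fst E (P ⧸ D1))) (b.comp (MonoidHom.snd E (P ⧸ D1)))
  have hX : ∀ z : E × (P ⧸ D1), z ∈ X ↔ (QuotientGroup.mk z.1 : E ⧸ K) = b z.2 := fun z => Iff.rfl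
  let f : X →* E := (MonoidHom.fst E (P ⧸ D1)).comp X.subtype
  have hf : Function.Surjective f := by
    intro x
    obtain ⟨u, hu⟩ := hbsurj (QuotientGroup.mk x)
    exact ⟨⟨(x, u), hu.symm⟩, rfl⟩
  let Y : Subgroup X := (P : Subgroup E).comap f
  have hYi : Y.index = (P : Subgroup E).index := Subgroup.index_comap_of_surjective _ hf
  have hφmem : ∀ y : Y, (y : X).1.2 * (QuotientGroup.mk (⟨(y : X).1.1, y.2⟩ : P) : P ⧸ D1)⁻¹ ∈ b.ker := by
    intro y
    rw [MonoidHom.mem_ker, map_mul, map_inv, hb]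
    have := (hX _).1 (y : X).2
    rw [← this]; simp
  let φ : Y →* b.ker :=
    { toFun := fun y => ⟨_, hφmem y⟩
      map_one' := by
        apply Subtype.ext
        change (1 : P ⧸ D1) * (QuotientGroup.mk (1 : P))⁻¹ = 1
        simp
      map_mul' := by
        intro y z
        apply Subtype.ext
        have h1 := hcen _ (hφmem z) (QuotientGroup.mk (⟨(y : X).1.1, y.2⟩ : P) : P ⧸ D1)⁻¹
        have h2 : (QuotientGroup.mk (⟨((y * z : Y) : X).1.1, (y*z).2⟩ : P) : P ⧸ D1)
          = QuotientGroup.mk (⟨(y : X).1.1, y.2⟩ : P) * QuotientGroup.mk (⟨(z : X).1.1, z.2⟩ : P) := rfl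
        change (y : X).1.2 * (z : X).1.2 * (QuotientGroup.mk (⟨((y * z : Y) : X).1.1, (y*z).2⟩ : P) : P ⧸ D1)⁻¹
          = ((y : X).1.2 * (QuotientGroup.mk (⟨(y : X).1.1, y.2⟩ : P) : P ⧸ D1)⁻¹) *
            ((z : X).1.2 * (QuotientGroup.mk (⟨(z : X).1.1, z.2⟩ : P) : P ⧸ D1)⁻¹)
        rw [h2, mul_inv_rev, mul_assoc, mul_assoc, ← h1]
        simp only [mul_assoc] }
  let τ : X →* b.ker := MonoidHom.transfer φ
  have hA : ∀ a (ha : a ∈ b.ker), ((1 : E), a) ∈ X := fun a ha => by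
    rw [hX]; rw [MonoidHom.mem_ker] at ha; simp [ha]
  have hτ : ∀ a (ha : a ∈ b.ker), τ ⟨(1, a), hA a ha⟩ = ⟨a, ha⟩ ^ (P : Subgroup E).index := by
    intro a ha
    have key : ∀ (k : ℕ) (g₀ : X), g₀⁻¹ * (⟨(1, a), hA a ha⟩ : X) ^ k * g₀ ∈ Y →
        g₀⁻¹ * (⟨(1, a), hA a ha⟩ : X) ^ k * g₀ = (⟨(1, a), hA a ha⟩ : X) ^ k := by
      intro k g₀ _
      apply Subtype.ext
      apply Prod.ext
      · simp
      · have := hcen (a ^ k) (b.ker.pow_mem ha k) g₀.1.2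
        simp [mul_assoc, this]
    have h := MonoidHom.transfer_eq_pow φ _ key
    change MonoidHom.transfer φ _ = _
    rw [h]
    apply Subtype.ext
    rw [← hYi]
    change (((⟨(1, a), hA a ha⟩ : X) ^ Y.index : X) : E × (P ⧸ D1)).2 * _⁻¹ = _
    have h5 : ∀ q : P, (q : E) = 1 → (QuotientGroup.mk q : P ⧸ D1) = 1 := by
      intro q hq
      have : q = 1 := Subtype.ext hq
      rw [this]; rfl
    rw [h5]
    · simp
    · simp
  have hPQ : IsPGroup p b.ker := (hPp.to_quotient D1).to_subgroup _
  have hcop : p.Coprime (P : Subgroup E).index := (Nat.Prime.coprime_iff_not_dvd hp.out).2 P.not_dvd_index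
  -- every element of X is T * A
  have hTA : ∀ z : X, ∃ a, ∃ ha : a ∈ b.ker, τ (z * ⟨(1, a), hA a ha⟩) = 1 := by
    intro z
    obtain ⟨⟨a, ha⟩, haz⟩ := (hPQ.powEquiv hcop).surjective (τ z)⁻¹
    rw [IsPGroup.powEquiv_apply] at haz
    refine ⟨a, ha, ?_⟩
    rw [map_mul, hτ a ha, haz, mul_inv_cancel]
  -- snd surjective on T
  have hsnd : ∀ u : P ⧸ D1, ∃ z : X, τ z = 1 ∧ z.1.2 = u := by
    let W0 : Subgroup (P ⧸ D1) := τ.ker.map ((MonoidHom.snd E (P ⧸ D1)).comp X.subtype)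
    have hW : W0.comap (QuotientGroup.mk' D1) = ⊤ := by
      apply hΦ
      rw [eq_top_iff]
      intro y _
      have hy : ((y : E), (QuotientGroup.mk y : P ⧸ D1)) ∈ X := by rw [hX, hb]
      obtain ⟨a, ha, haz⟩ := hTA ⟨_, hy⟩
      obtain ⟨d, hd, rfl⟩ := (hker a).1 ha
      have h1 : y * d ∈ W0.comap (QuotientGroup.mk' D1) := ⟨_, haz, rfl⟩
      have h2 : y = (y * d) * d⁻¹ := by group
      rw [h2]
      exact Subgroup.mul_mem_sup h1 (D.inv_mem hd)
    intro u
    obtain ⟨y, rfl⟩ := QuotientGroup.mk_surjective u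
    have : y ∈ W0.comap (QuotientGroup.mk' D1) := hW ▸ Subgroup.mem_top y
    obtain ⟨z, hz, hzy⟩ := this
    exact ⟨z, hz, hzy⟩
  have hfst : ∀ x : E, ∃ z : X, τ z = 1 ∧ z.1.1 = x := by
    intro x
    obtain ⟨z, hz⟩ := hf x
    obtain ⟨a, ha, haz⟩ := hTA z
    refine ⟨_, haz, ?_⟩
    change z.1.1 * 1 = x
    rw [mul_one]; exact hz
  let g : τ.ker →* (P ⧸ D1) := ((MonoidHom.snd E (P ⧸ D1)).comp X.subtype).comp τ.ker.subtype
  let f' : τ.ker →* E := f.comp τ.ker.subtype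
  have hf' : Function.Surjective f' := by
    intro x
    obtain ⟨z, hz, hzx⟩ := hfst x
    exact ⟨⟨z, hz⟩, hzx⟩
  have hKK : K ≤ g.ker.map f' := by
    apply hmin
    · exact Subgroup.Normal.map inferInstance f' hf'
    · have h1 : (g.ker.map f').index ∣ g.ker.index := Subgroup.index_map_dvd _ hf'
      rw [Subgroup.index_ker] at h1
      obtain ⟨n, hn⟩ := IsPGroup.iff_card.mp ((hPp.to_quotient D1).to_subgroup g.range)
      rw [hn] at h1
      obtain ⟨m, _, hm⟩ := (Nat.dvd_prime_pow hp.out).1 h1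
      exact ⟨m, hm⟩
  intro d hd
  obtain ⟨z, hz, hzd⟩ := hsnd (QuotientGroup.mk d)
  have hzK : z.1.1 ∈ K := by
    rw [← QuotientGroup.eq_one_iff, (hX _).1 z.2, hzd, hb, QuotientGroup.eq_one_iff]
    exact hd
  obtain ⟨⟨w, hw⟩, hwg, hwz⟩ := hKK hzK
  have hwg' : w.1.2 = 1 := hwg
  have hwz' : w.1.1 = z.1.1 := hwz
  have hdk : (QuotientGroup.mk d : P ⧸ D1) ∈ b.ker := (hker _).2 ⟨d, hd, rfl⟩
  have h1 : τ ⟨(1, QuotientGroup.mk d), hA _ hdk⟩ = 1 := by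
    have : (⟨(1, QuotientGroup.mk d), hA _ hdk⟩ : X) = w⁻¹ * z := by
      apply Subtype.ext
      apply Prod.ext
      · simp [hwz']
      · simp [hwg', hzd]
    rw [this, map_mul, map_inv, hz, MonoidHom.mem_ker.1 hw]; simp
  rw [hτ _ hdk] at h1
  have h2 : (⟨QuotientGroup.mk d, hdk⟩ : b.ker) = 1 := by
    apply (hPQ.powEquiv hcop).injective
    rw [IsPGroup.powEquiv_apply, IsPGroup.powEquiv_apply, h1, one_pow]
  have h3 : (QuotientGroup.mk d : P ⧸ D1) = 1 := congrArg Subtype.val h2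
  exact (QuotientGroup.eq_one_iff _).1 h3

theorem tate {E : Type*} [Group E] [Finite E] {p : ℕ} [hp : Fact p.Prime] (P : Sylow p E)
    (h : ∀ P1 : Subgroup E, P1 ≤ P → P1.relIndex P = p →
      ∃ L : Subgroup E, L.Normal ∧ P1 ≤ L ∧ L.index = p) :
    ∃ K : Subgroup E, K.Normal ∧ ¬ p ∣ Nat.card K ∧ ∃ n, K.index = p ^ n := by
  obtain ⟨K, ⟨hKn, hKi⟩, hKmin⟩ := (wellFounded_lt (α := Subgroup E)).has_min
    {K : Subgroup E | K.Normal ∧ ∃ n, K.index = p ^ n} ⟨⊤, inferInstance, 0, by simp⟩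
  have hmin : ∀ K' : Subgroup E, K'.Normal → (∃ n, K'.index = p ^ n) → K ≤ K' := by
    rintro K' hK' ⟨b, hb⟩
    have h1 : K ⊓ K' ∈ {K : Subgroup E | K.Normal ∧ ∃ n, K.index = p ^ n} := by
      refine ⟨inferInstance, ?_⟩
      obtain ⟨a, ha⟩ := hKi
      have h2 := Subgroup.relIndex_mul_index (inf_le_right : K ⊓ K' ≤ K')
      rw [Subgroup.inf_relIndex_right] at h2
      have h3 : K.relIndex K' ∣ K.index := Subgroup.relIndex_dvd_index_of_normal _ _
      have h4 : (K ⊓ K').index ∣ p ^ (a + b) := by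
        rw [← h2, pow_add, ← ha, ← hb]
        exact Nat.mul_dvd_mul_right h3 _
      obtain ⟨m, _, hm⟩ := (Nat.dvd_prime_pow hp.out).1 h4
      exact ⟨m, hm⟩
    have h5 := hKmin _ h1
    by_contra hne
    exact h5 (lt_of_le_of_ne inf_le_left (fun h => hne (inf_eq_left.1 h)))
  have hD : K.subgroupOf P = ⊥ := by
    apply tate_core P K hKi hmin
    intro W hW
    by_contra hWt
    obtain ⟨W1, hWW1, hW1⟩ := exists_index_p_ge P.isPGroup' W hWt
    obtain ⟨L, hL, hPL, hLi⟩ := h (W1.map (P : Subgroup E).subtype) (Subgroup.map_subtype_le _) (by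
      rw [relIndex_map_subtype', hW1])
    have hKL := hmin L hL ⟨1, by simpa using hLi⟩
    have h1 : (⊤ : Subgroup P) ≤ L.subgroupOf P := by
      rw [← hW]
      refine sup_le ?_ (Subgroup.comap_mono hKL)
      intro w hw
      exact hPL ⟨w, hWW1 hw, rfl⟩
    have h2 : (P : Subgroup E) ≤ L := Subgroup.subgroupOf_eq_top.1 (top_le_iff.1 h1)
    have h3 := Subgroup.index_dvd_of_le h2
    rw [hLi] at h3
    exact P.not_dvd_index h3
  refine ⟨K, hKn, ?_, hKi⟩
  have h1 : K.relIndex P = Nat.card P := by rw [Subgroup.relIndex, hD, Subgroup.index_bot]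
  obtain ⟨c, hc⟩ : K.relIndex P ∣ K.index := Subgroup.relIndex_dvd_index_of_normal _ _
  rw [h1] at hc
  have h2 := K.card_mul_index
  rw [hc, ← (P : Subgroup E).card_mul_index] at h2
  have h3 : Nat.card K * c = (P : Subgroup E).index := by
    apply Nat.eq_of_mul_eq_mul_left (Nat.card_pos (α := P))
    rw [← h2]; ring
  intro h4
  exact P.not_dvd_index (h3 ▸ h4.mul_right c)

theorem hall_characteristic {E : Type*} [Group E] [Finite E] {p : ℕ} [hp : Fact p.Prime]
    (K : Subgroup E) [K.Normal] (h1 : ¬ p ∣ Nat.card K) (h2 : ∃ n, K.index = p ^ n) :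
    K.Characteristic := by
  have key : ∀ x : E, (Nat.Coprime p (orderOf x)) → x ∈ K := by
    intro x hx
    obtain ⟨n, hn⟩ := h2
    rw [← QuotientGroup.eq_one_iff, ← orderOf_eq_one_iff]
    have a : orderOf (QuotientGroup.mk x : E ⧸ K) ∣ orderOf x := orderOf_map_dvd (QuotientGroup.mk' K) x
    have b : orderOf (QuotientGroup.mk x : E ⧸ K) ∣ p ^ n := by
      rw [← hn, Subgroup.index_eq_card]; exact orderOf_dvd_natCard _
    exact Nat.eq_one_of_dvd_coprimes (Nat.Coprime.pow_left n hx) b a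
  rw [Subgroup.characteristic_iff_map_le]
  rintro ϕ _ ⟨x, hx, rfl⟩
  apply key
  have : orderOf (ϕ.toMonoidHom x) = orderOf x := MulEquiv.orderOf_eq ϕ x
  rw [this]
  rw [Nat.Prime.coprime_iff_not_dvd hp.out]
  intro h3
  exact h1 (h3.trans (K.orderOf_dvd_natCard hx))


theorem eigen_lin {V : Type*} [AddCommGroup V] [Finite V] [Nontrivial V] {p : ℕ} [hp : Fact p.Prime]
    [Module (ZMod p) V] (f : Module.End (ZMod p) V) (hf0 : ∀ v, f^[p - 1] v = v) :
    ∃ k : ℕ, ∃ v : V, v ≠ 0 ∧ f v = k • v := by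
  have hf : f ^ (p - 1) = 1 := by
    apply LinearMap.ext
    intro v
    rw [Module.End.pow_apply]
    exact hf0 v
  have hfp : f ^ p = f := by
    have h2 : p - 1 + 1 = p := Nat.succ_pred_prime hp.out
    have h3 : f ^ (p - 1 + 1) = f := by rw [pow_succ, hf, one_mul]
    exact (congrArg (fun n => f ^ n) h2).symm.trans h3
  have hdvd : minpoly (ZMod p) f ∣ (Polynomial.X ^ p - Polynomial.X : Polynomial (ZMod p)) := by
    apply minpoly.dvd
    simp [hfp]
  have hspl : (Polynomial.X ^ p - Polynomial.X : Polynomial (ZMod p)).Splits := by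
    have := FiniteField.splits_X_pow_card_sub_X (K := ZMod p) p
    simpa [ZMod.card] using this
  have hspl2 : (minpoly (ZMod p) f).Splits :=
    hspl.of_dvd (FiniteField.X_pow_card_sub_X_ne_zero _ hp.out.one_lt) hdvd
  have hInt : IsIntegral (ZMod p) f := Algebra.IsIntegral.isIntegral f
  obtain ⟨μ, hμ⟩ := hspl2.exists_eval_eq_zero (minpoly.degree_pos hInt).ne'
  obtain ⟨v, hv⟩ := (Module.End.hasEigenvalue_of_isRoot hμ).exists_hasEigenvector
  refine ⟨μ.val, v, hv.2, ?_⟩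
  have h1 := hv.apply_eq_smul
  have h2 : μ • v = μ.val • v := by
    conv_lhs => rw [← ZMod.natCast_zmod_val μ]
    rw [Nat.cast_smul_eq_nsmul]
  rw [h1, h2]

theorem eigen_comm {V : Type*} [CommGroup V] [Finite V] [Nontrivial V] {p : ℕ} [hp : Fact p.Prime]
    (hexp : ∀ a : V, a ^ p = 1) (f : V →* V) (hf : ∀ v, f^[p - 1] v = v) :
    ∃ k : ℕ, ∃ v : V, v ≠ 1 ∧ f v = v ^ k := by
  let _ : Module (ZMod p) (Additive V) := AddCommGroup.zmodModule (n := p) (by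
    intro v
    exact hexp (Additive.toMul v))
  let F : Module.End (ZMod p) (Additive V) := (MonoidHom.toAdditive f).toZModLinearMap p
  have : Nontrivial (Additive V) := inferInstanceAs (Nontrivial V)
  have : Finite (Additive V) := inferInstanceAs (Finite V)
  obtain ⟨k, v, hv, h⟩ := eigen_lin F (fun v => hf (Additive.toMul v))
  exact ⟨k, Additive.toMul v, hv, h⟩

theorem exists_eigen {G : Type*} [Group G] [Finite G] {p : ℕ} [hp : Fact p.Prime]
    (N : Subgroup G) [hN : N.Normal] (hne : N ≠ ⊥) (hab : ∀ a ∈ N, ∀ b ∈ N, a * b = b * a)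
    (hexp : ∀ a ∈ N, a ^ p = 1) (x : G) (hx : ∀ n ∈ N, x ^ (p - 1) * n * (x ^ (p - 1))⁻¹ = n) :
    ∃ k : ℕ, ∃ n ∈ N, n ≠ 1 ∧ x * n * x⁻¹ = n ^ k := by
  have hnt : Nontrivial N := (Subgroup.nontrivial_iff_ne_bot N).2 hne
  have hf : ∀ k : ℕ, ∀ v : N, (((MulAut.conjNormal x : MulAut N)^[k] v : N) : G) = x ^ k * v * (x ^ k)⁻¹ := by
    intro k
    induction k with
    | zero => intro v; simp
    | succ k ih =>
      intro v
      rw [Function.iterate_succ_apply', MulAut.conjNormal_apply, ih, pow_succ']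
      group
  let cg : CommGroup N := { (inferInstance : Group N) with
    mul_comm := fun a b => Subtype.ext (hab a a.2 b b.2) }
  obtain ⟨k, v, hv, h⟩ := @eigen_comm N cg _ _ p _ (fun a => Subtype.ext (hexp a a.2))
    (MulAut.conjNormal x : MulAut N).toMonoidHom
    (fun v => Subtype.ext ((hf (p - 1) v).trans (hx v v.2)))
  refine ⟨k, v, v.2, fun h => hv (Subtype.ext h), ?_⟩
  exact congrArg Subtype.val h

theorem minNormal_elem {G : Type*} [Group G] [Finite G] {p : ℕ} [hp : Fact p.Prime]
    (N : Subgroup G) [hN : N.Normal] (hne : N ≠ ⊥) (hNp : IsPGroup p N)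
    (hmin : ∀ M : Subgroup G, M.Normal → M ≤ N → M ≠ ⊥ → M = N) :
    (∀ a ∈ N, ∀ b ∈ N, a * b = b * a) ∧ (∀ a ∈ N, a ^ p = 1) := by
  have hnt : Nontrivial N := (Subgroup.nontrivial_iff_ne_bot N).2 hne
  have hab : ∀ a ∈ N, ∀ b ∈ N, a * b = b * a := by
    have h1 : (Subgroup.center N).map N.subtype = N := by
      apply hmin _ inferInstance (Subgroup.map_subtype_le _)
      intro h
      rw [Subgroup.map_eq_bot_iff_of_injective _ N.subtype_injective] at h
      exact hNp.bot_lt_center.ne' h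
    intro a ha b hb
    rw [← h1] at ha
    obtain ⟨c, hc, rfl⟩ := ha
    have := (Subgroup.mem_center_iff.1 hc) ⟨b, hb⟩
    exact (congrArg Subtype.val this).symm
  refine ⟨hab, ?_⟩
  let M : Subgroup G :=
    { carrier := {n | n ∈ N ∧ n ^ p = 1}
      one_mem' := ⟨N.one_mem, one_pow _⟩
      mul_mem' := by
        rintro a b ⟨ha, ha'⟩ ⟨hb, hb'⟩
        refine ⟨N.mul_mem ha hb, ?_⟩
        have : Commute a b := hab a ha b hb
        rw [this.mul_pow, ha', hb', one_mul]
      inv_mem' := by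
        rintro a ⟨ha, ha'⟩
        exact ⟨N.inv_mem ha, by rw [inv_pow, ha', inv_one]⟩ }
  have hM : M = N := by
    apply hmin
    · constructor
      rintro n ⟨hn, hn'⟩ g
      exact ⟨hN.conj_mem n hn g, by rw [conj_pow, hn']; group⟩
    · exact fun n hn => hn.1
    · obtain h | h := hNp.card_eq_or_dvd
      · exact absurd ((Subgroup.card_eq_one).1 h) hne
      · obtain ⟨c, hc⟩ := exists_prime_orderOf_dvd_card' p h
        rw [Subgroup.ne_bot_iff_exists_ne_one]
        refine ⟨⟨c, c.2, ?_⟩, ?_⟩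
        · rw [← Subgroup.coe_pow, ← hc, pow_orderOf_eq_one]; rfl
        · intro h
          have h' : (c : G) = 1 := congrArg (fun z : M => (z : G)) h
          have : c = 1 := Subtype.ext h'
          rw [this, orderOf_one] at hc
          exact hp.out.one_lt.ne hc
  intro a ha
  rw [← hM] at ha
  exact ha.2

def PStep {G : Type*} [Group G] (A B : Subgroup G) : Prop :=
  A.Normal ∧ B.Normal ∧ A ≤ B ∧ (A.relIndex B).Prime

theorem chain_le {G : Type*} [Group G] {A B : Subgroup G} (h : Relation.ReflTransGen PStep A B) : A ≤ B := by
  induction h with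
  | refl => exact le_rfl
  | tail _ h ih => exact ih.trans h.2.2.1

def actTriv {G : Type*} [Group G] (P : Subgroup G) : Subgroup G where
  carrier := {g | ∀ A C : Subgroup G, PStep A C → C ≤ P → ∀ c ∈ C, g * c * g⁻¹ * c⁻¹ ∈ A}
  one_mem' := by
    intro A C _ _ c _
    simp [A.one_mem]
  mul_mem' := by
    intro g h hg hh A C hAC hC c hc
    have h1 := hAC.1.conj_mem _ (hh A C hAC hC c hc) g
    have h2 := A.mul_mem h1 (hg A C hAC hC c hc)
    have h3 : g * (h * c * h⁻¹ * c⁻¹) * g⁻¹ * (g * c * g⁻¹ * c⁻¹) = g * h * c * (g * h)⁻¹ * c⁻¹ := by group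
    rwa [h3] at h2
  inv_mem' := by
    intro g hg A C hAC hC c hc
    have h1 := hAC.1.conj_mem _ (A.inv_mem (hg A C hAC hC c hc)) g⁻¹
    have h3 : g⁻¹ * (g * c * g⁻¹ * c⁻¹)⁻¹ * g⁻¹⁻¹ = g⁻¹ * c * g⁻¹⁻¹ * c⁻¹ := by group
    rwa [h3] at h1

theorem actTriv_normal {G : Type*} [Group G] (P : Subgroup G) : (actTriv P).Normal := by
  constructor
  intro g hg x A C hAC hC c hc
  have h1 := hAC.1.conj_mem _ (hg A C hAC hC (x⁻¹ * c * x) (by simpa using hAC.2.1.conj_mem c hc x⁻¹)) x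
  have h3 : x * (g * (x⁻¹ * c * x) * g⁻¹ * (x⁻¹ * c * x)⁻¹) * x⁻¹ = x * g * x⁻¹ * c * (x * g * x⁻¹)⁻¹ * c⁻¹ := by group
  rwa [h3] at h1

theorem exists_rho {G : Type*} [Group G] [Finite G] (A C : Subgroup G) (h : PStep A C) :
    ∃ ρ : G →* (ZMod (A.relIndex C))ˣ, ∀ g, ρ g = 1 → ∀ c ∈ C, g * c * g⁻¹ * c⁻¹ ∈ A := by
  obtain ⟨hA, hC, hAC, hpr⟩ := h
  have hCn : (C.map (QuotientGroup.mk' A)).Normal := hC.map _ (QuotientGroup.mk'_surjective A)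
  have hcard : Nat.card (C.map (QuotientGroup.mk' A)) = A.relIndex C := by
    rw [← Subgroup.relIndex_ker, QuotientGroup.ker_mk']
  have : Fact (A.relIndex C).Prime := ⟨hpr⟩
  have hcyc : IsCyclic (C.map (QuotientGroup.mk' A)) := isCyclic_of_prime_card hcard
  rw [← hcard]
  let e := IsCyclic.mulAutMulEquiv (C.map (QuotientGroup.mk' A))
  refine ⟨(e.toMonoidHom.comp MulAut.conjNormal).comp (QuotientGroup.mk' A), ?_⟩
  intro g hg c hc
  have h1 : MulAut.conjNormal (QuotientGroup.mk' A g) = (1 : MulAut (C.map (QuotientGroup.mk' A))) := by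
    apply e.injective
    rw [map_one]; exact hg
  have h2 := congrArg (fun f => ((f ⟨QuotientGroup.mk' A c, ⟨c, hc, rfl⟩⟩ : C.map (QuotientGroup.mk' A)) : G ⧸ A)) h1
  simp only [MulAut.conjNormal_apply, MulAut.one_apply] at h2
  rw [← QuotientGroup.eq_one_iff]
  have h3 : (QuotientGroup.mk' A g) * (QuotientGroup.mk' A c) * (QuotientGroup.mk' A g)⁻¹ * (QuotientGroup.mk' A c)⁻¹ = 1 := by
    rw [h2, mul_inv_cancel]
  exact h3

theorem step_eq_p {G : Type*} [Group G] [Finite G] {p : ℕ} [hp : Fact p.Prime] {P : Subgroup G}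
    (hPp : IsPGroup p P) (A C : Subgroup G) (h : PStep A C) (hC : C ≤ P) : A.relIndex C = p := by
  obtain ⟨n, hn⟩ := IsPGroup.iff_card.mp (hPp.to_le hC)
  have h1 : A.relIndex C ∣ p ^ n := hn ▸ Subgroup.relIndex_dvd_card A C
  exact (Nat.prime_dvd_prime_iff_eq h.2.2.2 hp.out).1 (h.2.2.2.dvd_of_dvd_pow h1)

theorem pow_mem_actTriv {G : Type*} [Group G] [Finite G] {p : ℕ} [hp : Fact p.Prime] {P : Subgroup G}
    (hPp : IsPGroup p P) (x : G) : x ^ (p - 1) ∈ actTriv P := by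
  intro A C hAC hC
  obtain ⟨ρ, hρ⟩ := exists_rho A C hAC
  have e := step_eq_p hPp A C hAC hC
  have hf : Fact (A.relIndex C).Prime := ⟨hAC.2.2.2⟩
  apply hρ
  rw [map_pow]
  have h1 := ZMod.units_pow_card_sub_one_eq_one (A.relIndex C) (ρ x)
  exact (congrArg (fun n => ρ x ^ (n - 1)) e).symm.trans h1

theorem comm_mem_actTriv {G : Type*} [Group G] [Finite G] {P : Subgroup G}
    (x y : G) : x * y * x⁻¹ * y⁻¹ ∈ actTriv P := by
  intro A C hAC hC
  obtain ⟨ρ, hρ⟩ := exists_rho A C hAC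
  apply hρ
  simp only [map_mul, map_inv]
  rw [mul_comm (ρ x) (ρ y)]
  group


theorem coset_fix {G : Type*} [Group G] [Finite G] {p q : ℕ} [hp : Fact p.Prime] [hq : Fact q.Prime]
    (hpq : q ≠ p) {P Qs : Subgroup G} (hPp : IsPGroup p P) (hQ : IsPGroup q Qs) (hQB : Qs ≤ actTriv P)
    {A C : Subgroup G} (h : PStep A C) (hC : C ≤ P) :
    C ≤ (C ⊓ Subgroup.centralizer (Qs : Set G)) ⊔ A := by
  intro c hc
  let Ω := {y : G // c⁻¹ * y ∈ A}
  let act : MulAction Qs Ω :=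
    { smul := fun g y => ⟨(g : G) * y.1 * (g : G)⁻¹, by
        have h1 := h.1.conj_mem _ (hQB g.2 A C h hC c hc) c⁻¹
        have h2 := A.mul_mem h1 (h.1.conj_mem _ y.2 (g : G))
        have h3 : c⁻¹ * ((g : G) * c * (g : G)⁻¹ * c⁻¹) * c⁻¹⁻¹ * ((g : G) * (c⁻¹ * y.1) * (g : G)⁻¹)
          = c⁻¹ * ((g : G) * y.1 * (g : G)⁻¹) := by group
        rwa [h3] at h2⟩
      one_smul := by
        intro y
        apply Subtype.ext
        change ((1 : Qs) : G) * y.1 * ((1 : Qs) : G)⁻¹ = y.1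
        simp
      mul_smul := by
        intro a b y
        apply Subtype.ext
        change ((a * b : Qs) : G) * y.1 * ((a * b : Qs) : G)⁻¹ = (a : G) * ((b : G) * y.1 * (b : G)⁻¹) * (a : G)⁻¹
        simp [mul_assoc] }
  have hcard : Nat.card Ω = Nat.card A := by
    apply Nat.card_congr
    exact
      { toFun := fun y => ⟨c⁻¹ * y.1, y.2⟩
        invFun := fun a => ⟨c * a.1, by simp⟩
        left_inv := fun y => by simp
        right_inv := fun a => by simp }
  have hnd : ¬ q ∣ Nat.card Ω := by
    rw [hcard]
    obtain ⟨n, hn⟩ := IsPGroup.iff_card.mp (hPp.to_le (h.2.2.1.trans hC))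
    rw [hn]
    intro hd
    exact hpq ((Nat.prime_dvd_prime_iff_eq hq.out hp.out).1 (hq.out.dvd_of_dvd_pow hd))
  obtain ⟨y, hy⟩ := hQ.nonempty_fixed_point_of_prime_not_dvd_card Ω hnd
  have hyC : y.1 ∈ C := by
    have := C.mul_mem hc (h.2.2.1 y.2)
    simpa using this
  have hyZ : y.1 ∈ Subgroup.centralizer (Qs : Set G) := by
    rw [Subgroup.mem_centralizer_iff]
    intro g hg
    have h1 : g * y.1 * g⁻¹ = y.1 := congrArg Subtype.val (hy ⟨g, hg⟩)
    rw [mul_inv_eq_iff_eq_mul] at h1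
    exact h1
  have h2 : c = y.1 * (c⁻¹ * y.1)⁻¹ := by group
  rw [h2]
  exact Subgroup.mul_mem_sup ⟨hyC, hyZ⟩ (A.inv_mem y.2)

theorem chain_centralize {G : Type*} [Group G] [Finite G] {p q : ℕ} [hp : Fact p.Prime] [hq : Fact q.Prime]
    (hpq : q ≠ p) {P Qs N : Subgroup G} (hPp : IsPGroup p P) (hQ : IsPGroup q Qs) (hQB : Qs ≤ actTriv P)
    (hch : Relation.ReflTransGen PStep N P) (hF : ∀ W ≤ P, W ⊔ N = P → W = P) :
    P ≤ Subgroup.centralizer (Qs : Set G) := by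
  have key : P ≤ (P ⊓ Subgroup.centralizer (Qs : Set G)) ⊔ N := by
    clear hF
    induction hch using Relation.ReflTransGen.head_induction_on with
    | refl => exact le_sup_right
    | head h hc ih' =>
      rename_i A C
      have hCP := chain_le hc
      exact ih'.trans (sup_le le_sup_left ((coset_fix hpq hPp hQ hQB h hCP).trans
        (sup_le_sup_right (inf_le_inf_right _ hCP) A)))
  have := hF _ inf_le_left (le_antisymm (sup_le inf_le_left (chain_le hch)) key)
  rw [← this]
  exact inf_le_right

theorem eq_top_of_index {G : Type*} [Group G] [Finite G] (K : Subgroup G)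
    (h : ∀ q : ℕ, q.Prime → ¬ q ∣ K.index) : K = ⊤ := by
  rw [← Subgroup.index_eq_one]
  by_contra hne
  obtain ⟨q, hq, hd⟩ := Nat.exists_prime_and_dvd hne
  exact h q hq hd

theorem frattini_case {G : Type*} [Group G] [Finite G] {p : ℕ} [hp : Fact p.Prime]
    (P N : Subgroup G) [hN : N.Normal] (hPp : IsPGroup p P) (hNP : N ≤ P)
    (hne : N ≠ ⊥) (hmin : ∀ M : Subgroup G, M.Normal → M ≤ N → M ≠ ⊥ → M = N)
    (hch : Relation.ReflTransGen PStep N P) (hF : ∀ W ≤ P, W ⊔ N = P → W = P) : Nat.card N = p := by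
  have hBn : (actTriv P).Normal := actTriv_normal P
  have hNp : IsPGroup p N := hPp.to_le hNP
  obtain ⟨hab, hexp⟩ := minNormal_elem N hne hNp hmin
  have hcent : ∀ b ∈ actTriv P, ∀ n ∈ N, b * n = n * b := by
    obtain ⟨T⟩ : Nonempty (Sylow p (actTriv P)) := inferInstance
    have htop : (T : Subgroup (actTriv P)) ⊔ (Subgroup.centralizer (N : Set G)).subgroupOf (actTriv P) = ⊤ := by
      apply eq_top_of_index
      intro q hq hd
      have : Fact q.Prime := ⟨hq⟩
      by_cases hqp : q = p
      · subst hqp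
        exact T.not_dvd_index (hd.trans (Subgroup.index_dvd_of_le le_sup_left))
      · obtain ⟨Q⟩ : Nonempty (Sylow q (actTriv P)) := inferInstance
        have h1 : P ≤ Subgroup.centralizer (((Q : Subgroup (actTriv P)).map (actTriv P).subtype : Subgroup G) : Set G) :=
          chain_centralize hqp hPp (Q.2.map _) (Subgroup.map_subtype_le _) hch hF
        have h2 : (Q : Subgroup (actTriv P)) ≤ (Subgroup.centralizer (N : Set G)).subgroupOf (actTriv P) := by
          intro b hb
          rw [Subgroup.mem_subgroupOf, Subgroup.mem_centralizer_iff]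
          intro n hn
          have := (Subgroup.mem_centralizer_iff.1 (h1 (hNP hn))) b ⟨b, hb, rfl⟩
          exact this.symm
        exact Q.not_dvd_index (hd.trans (Subgroup.index_dvd_of_le (h2.trans le_sup_right)))
    let φ : T →* MulAut N := (MulAut.conjNormal.comp (actTriv P).subtype).comp (T : Subgroup (actTriv P)).subtype
    let _ : MulAction T N := MulAction.compHom N φ
    have hdv : p ∣ Nat.card N := by
      obtain h | h := hNp.card_eq_or_dvd
      · exact absurd ((Subgroup.card_eq_one).1 h) hne
      · exact h
    obtain ⟨n, hn, hn1⟩ := T.2.exists_fixed_point_of_prime_dvd_card_of_fixed_point N hdv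
      (a := (1 : N)) (by intro t; exact map_one (φ t))
    have hn2 : ∀ b ∈ actTriv P, b * n = n * b := by
      have h3 : (T : Subgroup (actTriv P)) ⊔ (Subgroup.centralizer (N : Set G)).subgroupOf (actTriv P)
          ≤ (Subgroup.centralizer {(n : G)}).subgroupOf (actTriv P) := by
        apply sup_le
        · intro b hb
          rw [Subgroup.mem_subgroupOf, Subgroup.mem_centralizer_singleton_iff]
          have h4 : (b : G) * n * (b : G)⁻¹ = n := congrArg Subtype.val (hn ⟨b, hb⟩)
          rw [mul_inv_eq_iff_eq_mul] at h4
          exact h4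
        · intro b hb
          rw [Subgroup.mem_subgroupOf, Subgroup.mem_centralizer_singleton_iff]
          rw [Subgroup.mem_subgroupOf, Subgroup.mem_centralizer_iff] at hb
          exact (hb n n.2).symm
      intro b hb
      have h5 : (⟨b, hb⟩ : actTriv P) ∈ (Subgroup.centralizer {(n : G)}).subgroupOf (actTriv P) := by
        apply h3; rw [htop]; trivial
      rw [Subgroup.mem_subgroupOf, Subgroup.mem_centralizer_singleton_iff] at h5
      exact h5
    have h6 : N ⊓ Subgroup.centralizer (actTriv P : Set G) = N := by
      apply hmin _ inferInstance inf_le_left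
      rw [Subgroup.ne_bot_iff_exists_ne_one]
      refine ⟨⟨n, n.2, ?_⟩, ?_⟩
      · exact Subgroup.mem_centralizer_iff.2 hn2
      · intro h
        apply hn1
        symm
        apply Subtype.ext
        exact congrArg (fun z : ↥(N ⊓ Subgroup.centralizer (actTriv P : Set G)) => (z : G)) h
    intro b hb m hm
    rw [← h6] at hm
    exact Subgroup.mem_centralizer_iff.1 hm.2 b hb
  have hpow : ∀ x : G, ∃ k : ℕ, ∀ n ∈ N, x * n * x⁻¹ = n ^ k := by
    intro x
    obtain ⟨k, m, hm, hm1, hmk⟩ := exists_eigen N hne hab hexp x (by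
      intro n hn
      rw [hcent _ (pow_mem_actTriv hPp x) n hn]; group)
    refine ⟨k, ?_⟩
    let M : Subgroup G :=
      { carrier := {n | n ∈ N ∧ x * n * x⁻¹ = n ^ k}
        one_mem' := ⟨N.one_mem, by simp⟩
        mul_mem' := by
          rintro a b ⟨ha, ha'⟩ ⟨hb, hb'⟩
          refine ⟨N.mul_mem ha hb, ?_⟩
          have : Commute a b := hab a ha b hb
          rw [this.mul_pow, ← ha', ← hb']; group
        inv_mem' := by
          rintro a ⟨ha, ha'⟩
          exact ⟨N.inv_mem ha, by rw [inv_pow, ← ha']; group⟩ }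
    have hM : M = N := by
      apply hmin
      · constructor
        rintro n ⟨hn, hn'⟩ g
        refine ⟨hN.conj_mem n hn g, ?_⟩
        rw [conj_pow, ← hn']
        have h1 := hcent _ (comm_mem_actTriv (P := P) (x⁻¹) (g⁻¹)) n hn
        have h2 : x * (g * n * g⁻¹) * x⁻¹ =
            g * x * ((x⁻¹ * g⁻¹ * x⁻¹⁻¹ * g⁻¹⁻¹) * n) * (x⁻¹ * g⁻¹ * x⁻¹⁻¹ * g⁻¹⁻¹)⁻¹ * (g * x)⁻¹ := by
          group
        rw [h2, h1]
        group
      · exact fun n hn => hn.1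
      · rw [Subgroup.ne_bot_iff_exists_ne_one]
        refine ⟨⟨m, hm, hmk⟩, ?_⟩
        intro h
        exact hm1 (congrArg (fun z : M => (z : G)) h)
    intro n hn
    rw [← hM] at hn
    exact hn.2
  obtain ⟨m, hm1⟩ := (Subgroup.ne_bot_iff_exists_ne_one).1 hne
  have hm1' : (m : G) ≠ 1 := fun h => hm1 (Subtype.ext h)
  have hz : Subgroup.zpowers (m : G) = N := by
    apply hmin
    · constructor
      intro n hn g
      obtain ⟨k, hk⟩ := hpow g
      have hnN : n ∈ N := (Subgroup.zpowers_le.2 m.2) hn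
      rw [hk n hnN]
      exact Subgroup.pow_mem _ hn k
    · exact Subgroup.zpowers_le.2 m.2
    · exact fun h => hm1' (Subgroup.zpowers_eq_bot.1 h)
  rw [← hz, Nat.card_zpowers]
  exact orderOf_eq_prime (hexp m m.2) hm1'


theorem le_normalizer_of_conj {G : Type*} [Group G] (K N1 : Subgroup G)
    (h : ∀ g ∈ K, ∀ n ∈ N1, g * n * g⁻¹ ∈ N1) : K ≤ Subgroup.normalizer (N1 : Set G) := by
  intro g hg
  rw [Subgroup.mem_normalizer_iff]
  intro n
  refine ⟨h g hg n, fun hn => ?_⟩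
  have := h g⁻¹ (K.inv_mem hg) _ hn
  have e : g⁻¹ * (g * n * g⁻¹) * g⁻¹⁻¹ = n := by group
  rwa [e] at this

theorem exists_chi {P : Type*} [Group P] [Finite P] {p : ℕ} [hp : Fact p.Prime] (hP : IsPGroup p P)
    (W : Subgroup P) (hW : W.index = p) : ∃ χ : P →* Multiplicative (ZMod p), χ.ker = W := by
  have hn : W.Normal := by
    obtain ⟨n, hn⟩ := IsPGroup.iff_card.mp hP
    apply Subgroup.normal_of_index_eq_minFac_card
    rw [hW, hn, Nat.Prime.pow_minFac hp.out]
    rintro rfl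
    have := W.index_dvd_card
    rw [hW, hn, pow_zero, Nat.dvd_one] at this
    exact hp.out.one_lt.ne' this
  have h1 : Nat.card (P ⧸ W) = p := hW
  have h2 : Nat.card (Multiplicative (ZMod p)) = p := by simp
  refine ⟨(mulEquivOfPrimeCardEq h1 h2).toMonoidHom.comp (QuotientGroup.mk' W), ?_⟩
  ext x
  simp

theorem card_range_zmod {P : Type*} [Group P] [Finite P] {p : ℕ} [hp : Fact p.Prime]
    (χ : P →* Multiplicative (ZMod p)) (h : χ ≠ 1) : Nat.card χ.range = p := by
  have h2 : Nat.card (Multiplicative (ZMod p)) = p := by simp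
  have h1 := Subgroup.card_subgroup_dvd_card χ.range
  rw [h2] at h1
  rcases (Nat.dvd_prime hp.out).1 h1 with h3 | h3
  · rw [Subgroup.card_eq_one, MonoidHom.range_eq_bot_iff] at h3
    exact absurd h3 h
  · exact h3

theorem nonfrattini_case {G : Type*} [Group G] [Finite G] {p : ℕ} [hp : Fact p.Prime]
    (P N : Subgroup G) [hPn : P.Normal] [hN : N.Normal] (hPp : IsPGroup p P) (hNP : N ≤ P)
    (hmin : ∀ M : Subgroup G, M.Normal → M ≤ N → M ≠ ⊥ → M = N)
    (P1 : Subgroup G) (hP1 : P1 ≤ P) (hidx : P1.relIndex P = p) (hN1 : ¬ N ≤ P1)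
    (hS : ∀ P1 : Subgroup G, P1 ≤ P → P1.relIndex P = p → ∃ S : Subgroup G, P1 ≤ S ∧ S.relIndex P = p ∧
      ∀ q : ℕ, q.Prime → q ∣ (S ⊔ Subgroup.centralizer (P : Set G)).index → q = p) : Nat.card N = p := by
  obtain ⟨χ0, hχ0⟩ := exists_chi hPp (P1.subgroupOf P) hidx
  let res : (P →* Multiplicative (ZMod p)) →* (N →* Multiplicative (ZMod p)) :=
    MonoidHom.compHom' (Subgroup.inclusion hNP)
  let Y := res.range
  have hfin : Finite (N →* Multiplicative (ZMod p)) := DFunLike.finite _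
  have hYp : IsPGroup p Y := by
    intro y
    refine ⟨1, ?_⟩
    apply Subtype.ext
    ext n
    rw [pow_one]
    have : (y.1 n) ^ p = 1 := by
      have h2 : Nat.card (Multiplicative (ZMod p)) = p := by simp
      exact (congrArg (fun k => (y.1 n) ^ k) h2).symm.trans pow_card_eq_one'
    exact congrArg Multiplicative.toAdd this
  have hYd : p ∣ Nat.card Y := by
    obtain h | h := hYp.card_eq_or_dvd
    · exfalso
      apply hN1
      have h1 : res χ0 = 1 := by
        have : res χ0 ∈ Y := ⟨χ0, rfl⟩
        rw [Subgroup.card_eq_one.1 h] at this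
        exact this
      intro n hn
      have h2 : χ0 ⟨n, hNP hn⟩ = 1 := DFunLike.congr_fun h1 ⟨n, hn⟩
      rw [← MonoidHom.mem_ker, hχ0] at h2
      exact h2
    · exact h
  obtain ⟨T⟩ : Nonempty (Sylow p G) := inferInstance
  let act : MulAction T Y :=
    { smul := fun t y => ⟨y.1.comp (MulAut.conjNormal (t : G)⁻¹ : MulAut N).toMonoidHom, by
        obtain ⟨χ, hχ⟩ := y.2
        refine ⟨χ.comp (MulAut.conjNormal (t : G)⁻¹ : MulAut P).toMonoidHom, ?_⟩
        rw [← hχ]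
        rfl⟩
      one_smul := by
        intro y
        apply Subtype.ext
        ext n
        change Multiplicative.toAdd (y.1 ((MulAut.conjNormal (((1 : T) : G))⁻¹ : MulAut N) n)) = _
        simp
      mul_smul := by
        intro a b y
        apply Subtype.ext
        ext n
        change Multiplicative.toAdd (y.1 ((MulAut.conjNormal (((a * b : T) : G))⁻¹ : MulAut N) n)) =
          Multiplicative.toAdd (y.1 ((MulAut.conjNormal (b : G)⁻¹ : MulAut N) ((MulAut.conjNormal (a : G)⁻¹ : MulAut N) n)))
        simp }
  obtain ⟨y, hy, hy1⟩ := T.2.exists_fixed_point_of_prime_dvd_card_of_fixed_point Y hYd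
      (a := (1 : Y)) (by intro t; rfl)
  obtain ⟨ψ, χ, hχ⟩ := y
  have hψ1 : ψ ≠ 1 := fun h => hy1 (Subtype.ext h.symm)
  have hψχ : ∀ n (hn : n ∈ N), ψ ⟨n, hn⟩ = χ ⟨n, hNP hn⟩ := fun n hn => (DFunLike.congr_fun hχ ⟨n, hn⟩).symm
  have hχ1 : χ ≠ 1 := by
    rintro rfl
    apply hψ1
    ext n
    rw [hψχ n.1 n.2]
    rfl
  have hidx' : (χ.ker.map P.subtype).relIndex P = p := by
    rw [relIndex_map_subtype', Subgroup.index_ker, card_range_zmod χ hχ1]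
  obtain ⟨S, hS1, hS2, hS3⟩ := hS _ (Subgroup.map_subtype_le _) hidx'
  have hSP : S ⊓ P ≤ χ.ker.map P.subtype := by
    rw [← Subgroup.relIndex_eq_one]
    have h1 := Subgroup.relIndex_mul_relIndex (χ.ker.map P.subtype) (S ⊓ P) P
      (le_inf hS1 (Subgroup.map_subtype_le _)) inf_le_right
    rw [Subgroup.inf_relIndex_right, hS2, hidx'] at h1
    exact Nat.eq_of_mul_eq_mul_right hp.out.pos (by rw [h1, one_mul])
  let N1 := ψ.ker.map N.subtype
  have hmem : ∀ n, n ∈ N1 ↔ ∃ hn : n ∈ N, ψ ⟨n, hn⟩ = 1 := by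
    intro n
    constructor
    · rintro ⟨m, hm, rfl⟩
      exact ⟨m.2, hm⟩
    · rintro ⟨hn, h⟩
      exact ⟨⟨n, hn⟩, h, rfl⟩
  have hN1S : ∀ n, n ∈ N1 ↔ n ∈ S ∧ n ∈ N := by
    intro n
    rw [hmem]
    constructor
    · rintro ⟨hn, h⟩
      exact ⟨hS1 ⟨⟨n, hNP hn⟩, by rw [hψχ] at h; exact h, rfl⟩, hn⟩
    · rintro ⟨hnS, hn⟩
      refine ⟨hn, ?_⟩
      obtain ⟨m, hm, hmn⟩ := hSP ⟨hnS, hNP hn⟩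
      rw [hψχ]
      have : m = ⟨n, hNP hn⟩ := Subtype.ext hmn
      rw [← this]
      exact hm
  have h1 : S ≤ Subgroup.normalizer (N1 : Set G) := by
    apply le_normalizer_of_conj
    intro g hg n hn
    rw [hN1S] at hn ⊢
    exact ⟨S.mul_mem (S.mul_mem hg hn.1) (S.inv_mem hg), hN.conj_mem _ hn.2 _⟩
  have h2 : Subgroup.centralizer (P : Set G) ≤ Subgroup.normalizer (N1 : Set G) := by
    apply le_normalizer_of_conj
    intro g hg n hn
    have h3 := (Subgroup.mem_centralizer_iff.1 hg) n (hNP ((hN1S n).1 hn).2)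
    rw [← h3]
    simpa using hn
  have h3 : (T : Subgroup G) ≤ Subgroup.normalizer (N1 : Set G) := by
    apply le_normalizer_of_conj
    intro g hg n hn
    rw [hmem] at hn ⊢
    obtain ⟨hn, h⟩ := hn
    refine ⟨hN.conj_mem _ hn _, ?_⟩
    have h5 := congrArg Subtype.val (hy (⟨g, hg⟩⁻¹))
    have h6 : ψ ((MulAut.conjNormal (((⟨g, hg⟩⁻¹ : T) : G))⁻¹ : MulAut N) ⟨n, hn⟩) = ψ ⟨n, hn⟩ :=
      DFunLike.congr_fun h5 ⟨n, hn⟩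
    have h7 : (MulAut.conjNormal (((⟨g, hg⟩⁻¹ : T) : G))⁻¹ : MulAut N) ⟨n, hn⟩ = ⟨g * n * g⁻¹, hN.conj_mem _ hn _⟩ := by
      apply Subtype.ext
      simp
    rw [h7] at h6
    rw [h6, h]
  have h4 : Subgroup.normalizer (N1 : Set G) = ⊤ := by
    apply eq_top_of_index
    intro q hq hd
    have := hS3 q hq (hd.trans (Subgroup.index_dvd_of_le (sup_le h1 h2)))
    subst this
    exact T.not_dvd_index (hd.trans (Subgroup.index_dvd_of_le h3))
  have hN1n : N1.Normal := Subgroup.normalizer_eq_top_iff.1 h4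
  have hbot : N1 = ⊥ := by
    by_contra hb
    have h5 := hmin N1 hN1n (Subgroup.map_subtype_le _) hb
    apply hψ1
    ext n
    have h6 : (n : G) ∈ N1 := by rw [h5]; exact n.2
    rw [hmem] at h6
    obtain ⟨h7, h8⟩ := h6
    exact congrArg Multiplicative.toAdd h8
  have hinj : Function.Injective ψ := by
    rw [← MonoidHom.ker_eq_bot_iff]
    rwa [Subgroup.map_eq_bot_iff_of_injective _ N.subtype_injective] at hbot
  rw [← card_range_zmod ψ hψ1]
  exact Nat.card_congr (MonoidHom.ofInjective hinj).toEquiv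


def SCond {G : Type*} [Group G] (p : ℕ) (P E : Subgroup G) : Prop :=
  IsCyclic P ∨ ∀ P1 : Subgroup G, P1 ≤ P → P1.relIndex P = p → ∃ S : Subgroup G, P1 ≤ S ∧ S.relIndex E = p ∧
      ∀ q : ℕ, q.Prime → q ∣ (S ⊔ Subgroup.centralizer (P : Set G)).index → q = p

theorem scond_quot {G : Type*} [Group G] {p : ℕ} {P E : Subgroup G} (N : Subgroup G) [N.Normal]
    (hEP : E.map (QuotientGroup.mk' N) = P.map (QuotientGroup.mk' N))
    (hN : ∀ P1 S : Subgroup G, N ⊓ P ≤ P1 → P1 ≤ S → S.relIndex E = p → N ≤ S)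
    (h : SCond p P E) :
    SCond p (E.map (QuotientGroup.mk' N)) (E.map (QuotientGroup.mk' N)) := by
  rcases h with h | h
  · left
    rw [hEP]
    exact isCyclic_of_surjective ((QuotientGroup.mk' N).subgroupMap P) ((QuotientGroup.mk' N).subgroupMap_surjective P)
  · right
    intro Q hQ hQi
    have h1 : (Q.comap (QuotientGroup.mk' N) ⊓ P).relIndex P = p := by
      rw [Subgroup.inf_relIndex_right, Subgroup.relIndex_comap, ← hEP, hQi]
    obtain ⟨S, hS1, hS2, hS3⟩ := h _ inf_le_right h1
    have hNS : N ≤ S := hN _ S (by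
      refine inf_le_inf_right P ?_
      intro n hn
      rw [Subgroup.mem_comap]
      have : QuotientGroup.mk' N n = 1 := (QuotientGroup.eq_one_iff n).2 hn
      rw [this]; exact Q.one_mem) hS1 hS2
    have hcm : (S.map (QuotientGroup.mk' N)).comap (QuotientGroup.mk' N) = S := by
      rw [Subgroup.comap_map_eq, QuotientGroup.ker_mk', sup_eq_left.2 hNS]
    refine ⟨S.map (QuotientGroup.mk' N), ?_, ?_, ?_⟩
    · intro y hy
      have hy' := hQ hy
      rw [hEP] at hy'
      obtain ⟨x, hx, rfl⟩ := hy'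
      exact ⟨x, hS1 ⟨hy, hx⟩, rfl⟩
    · rw [← Subgroup.relIndex_comap, hcm, hS2]
    · intro q hq hd
      apply hS3 q hq
      rw [← Subgroup.index_comap_of_surjective _ (QuotientGroup.mk'_surjective N)] at hd
      refine hd.trans (Subgroup.index_dvd_of_le (sup_le ?_ ?_))
      · exact (Subgroup.map_le_iff_le_comap).1 le_sup_left
      · intro g hg
        refine Subgroup.mem_comap.2 (Subgroup.mem_sup_right ?_)
        rw [Subgroup.mem_centralizer_iff]
        rw [hEP]
        rintro _ ⟨x, hx, rfl⟩
        rw [← map_mul, ← map_mul, (Subgroup.mem_centralizer_iff.1 hg) x hx]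

theorem pstep_comap {G : Type*} [Group G] (N : Subgroup G) [N.Normal] {A B : Subgroup (G ⧸ N)} (h : PStep A B) :
    PStep (A.comap (QuotientGroup.mk' N)) (B.comap (QuotientGroup.mk' N)) := by
  obtain ⟨h1, h2, h3, h4⟩ := h
  refine ⟨h1.comap _, h2.comap _, Subgroup.comap_mono h3, ?_⟩
  rw [Subgroup.relIndex_comap, Subgroup.map_comap_eq_self_of_surjective (QuotientGroup.mk'_surjective N)]
  exact h4

theorem chain_comap {G : Type*} [Group G] (N : Subgroup G) [N.Normal] {E : Subgroup G} (hNE : N ≤ E)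
    (h : Relation.ReflTransGen PStep ⊥ (E.map (QuotientGroup.mk' N))) : Relation.ReflTransGen PStep N E := by
  have := Relation.ReflTransGen.lift (p := PStep) (fun A : Subgroup (G ⧸ N) => A.comap (QuotientGroup.mk' N))
    (fun _ _ h => pstep_comap N h) _ _ h
  have e : (⊥ : Subgroup (G ⧸ N)).comap (QuotientGroup.mk' N) = N := by
    rw [MonoidHom.comap_bot, QuotientGroup.ker_mk']
  rw [Function.onFun, e] at this
  rwa [Subgroup.comap_map_eq, QuotientGroup.ker_mk', sup_eq_left.2 hNE] at this

theorem base_chain.{u} {p : ℕ} [hp : Fact p.Prime] (n : ℕ) : ∀ (G : Type u) [Group G] [Finite G] (P : Subgroup G),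
    P.Normal → IsPGroup p P → SCond p P P → Nat.card P ≤ n → Relation.ReflTransGen PStep ⊥ P := by
  induction n with
  | zero =>
    intro G _ _ P _ _ _ h
    exact absurd h (by have : 0 < Nat.card P := Nat.card_pos; omega)
  | succ n ih =>
    intro G _ _ P hPn hPp hS hc
    by_cases hb : P = ⊥
    · rw [hb]
    obtain ⟨N, ⟨hN, hNP, hne⟩, hmin0⟩ := (wellFounded_lt (α := Subgroup G)).has_min
      {M : Subgroup G | M.Normal ∧ M ≤ P ∧ M ≠ ⊥} ⟨P, hPn, le_rfl, hb⟩
    have hmin : ∀ M : Subgroup G, M.Normal → M ≤ N → M ≠ ⊥ → M = N := by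
      intro M h1 h2 h3
      by_contra h4
      exact hmin0 M ⟨h1, h2.trans hNP, h3⟩ (lt_of_le_of_ne h2 h4)
    have hNp : IsPGroup p N := hPp.to_le hNP
    obtain ⟨hab, hexp⟩ := minNormal_elem N hne hNp hmin
    have hch : Relation.ReflTransGen PStep N P := by
      apply chain_comap N hNP
      apply ih (G ⧸ N) (P.map (QuotientGroup.mk' N)) (hPn.map _ (QuotientGroup.mk'_surjective N))
        (hPp.map _)
      · exact scond_quot N rfl (fun P1 S h1 h2 _ => (le_inf le_rfl hNP).trans (h1.trans h2)) hS
      · have h1 : Nat.card (P.map (QuotientGroup.mk' N)) = N.relIndex P := by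
          rw [← Subgroup.relIndex_ker, QuotientGroup.ker_mk']
        have h2 := Subgroup.relIndex_mul_relIndex ⊥ N P bot_le hNP
        rw [Subgroup.relIndex_bot_left, Subgroup.relIndex_bot_left, mul_comm] at h2
        have h3 : 1 < Nat.card N := by
          have : Nontrivial N := (Subgroup.nontrivial_iff_ne_bot N).2 hne
          exact Finite.one_lt_card
        have h4 : 0 < Nat.card P := Nat.card_pos
        rw [h1]
        by_contra hcon
        push Not at hcon
        have : N.relIndex P * 2 ≤ N.relIndex P * Nat.card N := Nat.mul_le_mul_left _ h3
        omega
    have hcard : Nat.card N = p := by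
      rcases hS with hcyc | hS
      · have : IsCyclic N := by
          exact isCyclic_of_injective (Subgroup.inclusion hNP) (Subgroup.inclusion_injective hNP)
        obtain ⟨g, hg⟩ := IsCyclic.exists_generator (α := N)
        rw [← orderOf_eq_card_of_forall_mem_zpowers hg]
        apply orderOf_eq_prime (Subtype.ext (hexp g g.2))
        rintro rfl
        apply hne
        rw [eq_bot_iff]
        intro x hx
        have := hg ⟨x, hx⟩
        rw [Subgroup.zpowers_one_eq_bot, Subgroup.mem_bot] at this
        exact congrArg Subtype.val this
      · by_cases hex : ∃ P1 : Subgroup G, P1 ≤ P ∧ P1.relIndex P = p ∧ ¬ N ≤ P1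
        · obtain ⟨P1, h1, h2, h3⟩ := hex
          exact nonfrattini_case P N hPp hNP hmin P1 h1 h2 h3 hS
        · push Not at hex
          apply frattini_case P N hPp hNP hne hmin hch
          intro W hW hWN
          by_contra hWP
          have h1 : W.subgroupOf P ≠ ⊤ := fun h => hWP (le_antisymm hW (Subgroup.subgroupOf_eq_top.1 h))
          obtain ⟨W1, h2, h3⟩ := exists_index_p_ge hPp _ h1
          have h4 : (W1.map P.subtype).relIndex P = p := by rw [relIndex_map_subtype', h3]
          have h5 := hex _ (Subgroup.map_subtype_le _) h4
          have h6 : W ≤ W1.map P.subtype := by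
            intro w hw
            exact ⟨⟨w, hW hw⟩, h2 hw, rfl⟩
          have h7 : P ≤ W1.map P.subtype := by
            conv_lhs => rw [← hWN]
            exact sup_le h6 h5
          rw [Subgroup.relIndex_eq_one.2 h7] at h4
          exact hp.out.one_lt.ne h4
    refine Relation.ReflTransGen.head ⟨inferInstance, hN, bot_le, ?_⟩ hch
    rw [Subgroup.relIndex_bot_left, hcard]
    exact hp.out


def Cond {G : Type*} [Group G] (E : Subgroup G) : Prop :=
  ∀ p : ℕ, p.Prime → ∃ P : Subgroup G, P ≤ E ∧ IsPGroup p P ∧ ¬ p ∣ P.relIndex E ∧ SCond p P E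

theorem relIndex_sup_normal {G : Type*} [Group G] [Finite G] (S M : Subgroup G) [M.Normal] :
    S.relIndex (S ⊔ M) = S.relIndex M := by
  have h1 := Subgroup.relIndex_mul_relIndex (S ⊓ M) S (S ⊔ M) inf_le_left le_sup_left
  have h2 := Subgroup.relIndex_mul_relIndex (S ⊓ M) M (S ⊔ M) inf_le_right le_sup_right
  rw [Subgroup.inf_relIndex_right, Subgroup.relIndex_sup_right, ← h1, Subgroup.inf_relIndex_left, mul_comm] at h2
  have h3 : M.relIndex S ≠ 0 := Subgroup.index_ne_zero_of_finite
  exact (Nat.eq_of_mul_eq_mul_left (Nat.pos_of_ne_zero h3) h2).symm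

theorem relIndex_dvd_of_normal' {G : Type*} [Group G] [Finite G] (S M E : Subgroup G) [M.Normal] (h : M ≤ E) :
    S.relIndex M ∣ S.relIndex E := by
  have h1 : (S ⊓ E).relIndex M = S.relIndex M := by
    rw [← Subgroup.inf_relIndex_right, inf_assoc, inf_eq_right.2 h, Subgroup.inf_relIndex_right]
  have h2 := Subgroup.relIndex_mul_relIndex (S ⊓ E) ((S ⊓ E) ⊔ M) E le_sup_left (sup_le inf_le_right h)
  rw [Subgroup.inf_relIndex_right, relIndex_sup_normal, h1] at h2
  exact ⟨_, h2.symm⟩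

theorem relIndex_dvd_of_normal'' {G : Type*} [Group G] (Q M E : Subgroup G) [M.Normal] (hQ : Q ≤ E) (h : M ≤ E) :
    M.relIndex Q ∣ M.relIndex E := by
  have h2 := Subgroup.relIndex_mul_relIndex M (Q ⊔ M) E le_sup_right (sup_le hQ h)
  rw [Subgroup.relIndex_sup_right] at h2
  exact ⟨_, h2.symm⟩

theorem exists_complement {G : Type*} [Group G] [Finite G] {p : ℕ} [hp : Fact p.Prime] (E : Subgroup G)
    (hmf : (Nat.card E).minFac = p) (P : Subgroup G) (hPE : P ≤ E) (hPp : IsPGroup p P)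
    (hPi : ¬ p ∣ P.relIndex E) (hS : SCond p P E) :
    ∃ K : Subgroup E, K.Normal ∧ ¬ p ∣ Nat.card K ∧ ∃ n, K.index = p ^ n := by
  let P' : Sylow p E := (hPp.comap_subtype (K := E)).toSylow hPi
  have hP' : (P' : Subgroup E) = P.subgroupOf E := rfl
  have hmap : (P' : Subgroup E).map E.subtype = P := by
    rw [hP', Subgroup.map_subgroupOf_eq_of_le hPE]
  rcases hS with hc | hS
  · have hc' : IsCyclic P' := by
      have := (Subgroup.subgroupOfEquivOfLe hPE)
      exact isCyclic_of_injective this.toMonoidHom this.injective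
    refine ⟨(MonoidHom.transferSylow P' (hc'.normalizer_le_centralizer hmf)).ker, inferInstance,
      MonoidHom.not_dvd_card_ker_transferSylow P' _, ?_⟩
    have h1 := (IsCyclic.isComplement' hmf hc').symm.index_eq_card
    rw [h1]
    exact IsPGroup.iff_card.mp P'.2
  · apply tate P'
    intro P1 hP1 hi
    have h1 : (P1.map E.subtype).relIndex P = p := by
      conv_lhs => rw [← hmap]
      rw [Subgroup.relIndex_map_map_of_injective _ _ E.subtype_injective, hi]
    have h2 : P1.map E.subtype ≤ P := by
      rw [← hmap]
      exact Subgroup.map_mono hP1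
    obtain ⟨S, hS1, hS2, _⟩ := hS _ h2 h1
    have h3 : (S.subgroupOf E).index = p := hS2
    refine ⟨S.subgroupOf E, ?_, ?_, h3⟩
    · apply Subgroup.normal_of_index_eq_minFac_card
      rw [h3, hmf]
    · exact Subgroup.map_le_iff_le_comap.1 hS1

theorem main_chain {G : Type*} [Group G] [Finite G] (n : ℕ) : ∀ (E : Subgroup G),
    E.Normal → Cond E → Nat.card E ≤ n → Relation.ReflTransGen PStep ⊥ E := by
  induction n with
  | zero =>
    intro E _ _ h
    exact absurd h (by have : 0 < Nat.card E := Nat.card_pos; omega)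
  | succ n ih =>
    intro E hE hcond hc
    by_cases hb : E = ⊥
    · rw [hb]
    have hc1 : Nat.card E ≠ 1 := fun h => hb (Subgroup.card_eq_one.1 h)
    obtain ⟨p, hmf⟩ : ∃ p, (Nat.card E).minFac = p := ⟨_, rfl⟩
    have hpp : p.Prime := hmf ▸ Nat.minFac_prime hc1
    have hp : Fact p.Prime := ⟨hpp⟩
    obtain ⟨P, hPE, hPp, hPi, hPS⟩ := hcond p hpp
    obtain ⟨K, hK, hKc, m, hKi⟩ := exists_complement E hmf P hPE hPp hPi hPS
    have hchar : K.Characteristic := hall_characteristic K hKc ⟨m, hKi⟩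
    obtain ⟨M, hM⟩ : ∃ M, M = K.map E.subtype := ⟨_, rfl⟩
    have hMn : M.Normal := by rw [hM]; infer_instance
    have hME : M ≤ E := hM ▸ Subgroup.map_subtype_le _
    have hMi : M.relIndex E = p ^ m := by rw [hM, relIndex_map_subtype', hKi]
    have hMc : ¬ p ∣ Nat.card M := by
      rw [hM, Subgroup.card_map_of_injective E.subtype_injective]
      exact hKc
    have hlt : Nat.card M < Nat.card E := by
      apply lt_of_le_of_ne (Nat.le_of_dvd Nat.card_pos (Subgroup.card_dvd_of_le hME))
      intro h
      rw [h] at hMc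
      exact hMc (hmf ▸ Nat.minFac_dvd _)
    have hcop : ∀ q : ℕ, q.Prime → q ≠ p → Nat.Coprime q (p ^ m) := fun q hq hqp =>
      Nat.Coprime.pow_right _ ((Nat.coprime_primes hq hpp).2 hqp)
    have chain1 : Relation.ReflTransGen PStep ⊥ M := by
      apply ih M hMn _ (by omega)
      intro q hq
      by_cases hqp : q = p
      · subst hqp
        refine ⟨⊥, bot_le, IsPGroup.of_bot, ?_, Or.inl inferInstance⟩
        rw [Subgroup.relIndex_bot_left]
        exact hMc
      · have hcq := hcop q hq hqp
        have : Fact q.Prime := ⟨hq⟩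
        obtain ⟨Q, hQE, hQp, hQi, hQS⟩ := hcond q hq
        have hQM : Q ≤ M := by
          rw [← Subgroup.relIndex_eq_one]
          have h1 := relIndex_dvd_of_normal'' Q M E hQE hME
          rw [hMi] at h1
          obtain ⟨a, ha⟩ := IsPGroup.iff_card.mp hQp
          have h2 := Subgroup.relIndex_dvd_card M Q
          rw [ha] at h2
          exact Nat.eq_one_of_dvd_coprimes (hcq.pow_left a) h2 h1
        refine ⟨Q, hQM, hQp, ?_, ?_⟩
        · intro h
          apply hQi
          rw [← Subgroup.relIndex_mul_relIndex Q M E hQM hME]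
          exact h.mul_right _
        · rcases hQS with h | h
          · exact Or.inl h
          · right
            intro P1 h1 h2
            obtain ⟨S, hS1, hS2, hS3⟩ := h P1 h1 h2
            refine ⟨S, hS1, ?_, hS3⟩
            have h3 := relIndex_dvd_of_normal' S M E hME
            rw [hS2] at h3
            apply Nat.dvd_antisymm h3
            have h4 := Subgroup.relIndex_mul_relIndex (S ⊓ M) M E inf_le_right hME
            have h5 := Subgroup.relIndex_mul_relIndex (S ⊓ M) (S ⊓ E) E (inf_le_inf_left _ hME) inf_le_right
            rw [Subgroup.inf_relIndex_right, hMi, ← h5, Subgroup.inf_relIndex_right, hS2] at h4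
            exact hcq.dvd_of_dvd_mul_right (h4 ▸ dvd_mul_left _ _)
    have chain2 : Relation.ReflTransGen PStep M E := by
      apply chain_comap M hME
      have hPM : E = P ⊔ M := by
        apply le_antisymm _ (sup_le hPE hME)
        rw [← Subgroup.relIndex_eq_one]
        have h1 := Subgroup.relIndex_dvd_of_le_left E (le_sup_left : P ≤ P ⊔ M)
        have h2 := Subgroup.relIndex_dvd_of_le_left E (le_sup_right : M ≤ P ⊔ M)
        rw [hMi] at h2
        refine Nat.eq_one_of_dvd_coprimes ?_ h2 h1
        exact Nat.Coprime.pow_left _ ((Nat.Prime.coprime_iff_not_dvd hpp).2 hPi)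
      have hEP : E.map (QuotientGroup.mk' M) = P.map (QuotientGroup.mk' M) := by
        rw [hPM, Subgroup.map_sup, (Subgroup.map_eq_bot_iff (f := QuotientGroup.mk' M) M).2 (by rw [QuotientGroup.ker_mk']), sup_bot_eq]
      apply base_chain (p := p) _ (G ⧸ M) _ (hE.map _ (QuotientGroup.mk'_surjective M)) _ _ le_rfl
      · rw [hEP]
        exact hPp.map _
      · apply scond_quot M hEP _ hPS
        intro P1 S _ _ hS
        rw [← Subgroup.relIndex_eq_one]
        have h3 := relIndex_dvd_of_normal' S M E hME
        rw [hS] at h3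
        have h4 := Subgroup.relIndex_dvd_card S M
        exact Nat.eq_one_of_dvd_coprimes ((Nat.Prime.coprime_iff_not_dvd hpp).2 hMc) h3 h4
    exact chain1.trans chain2


theorem nilp_comm {X : Type*} [Group X] [Finite X] (hX : Group.IsNilpotent X) {p q : ℕ} [hp : Fact p.Prime]
    [hq : Fact q.Prime] (hpq : p ≠ q) (A B : Subgroup X) (hA : IsPGroup p A) (hB : IsPGroup q B) :
    ∀ a ∈ A, ∀ b ∈ B, a * b = b * a := by
  obtain ⟨P, hP⟩ := hA.exists_le_sylow
  obtain ⟨Q, hQ⟩ := hB.exists_le_sylow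
  have hn := (Group.isNilpotent_of_finite_tfae (G := X)).out 0 3 rfl rfl |>.mp hX
  intro a ha b hb
  exact Subgroup.commute_of_normal_of_disjoint P Q (hn p hp P) (hn q hq Q)
    (IsPGroup.disjoint_of_ne p q hpq _ _ P.2 Q.2) a b (hP ha) (hQ hb)

theorem nilp_index_p {X : Type*} [Group X] [Finite X] (hX : Group.IsNilpotent X) {p : ℕ} [hp : Fact p.Prime]
    (P : Sylow p X) (W : Subgroup X) (hW : W ≤ P) (hi : W.relIndex P = p) :
    ∃ R : Subgroup X, W ≤ R ∧ R.index = p := by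
  have hn := (Group.isNilpotent_of_finite_tfae (G := X)).out 0 3 rfl rfl |>.mp hX
  have hPn := hn p hp P
  obtain ⟨Q, hQ⟩ := Subgroup.exists_right_complement'_of_coprime P.card_coprime_index
  have hQc : Nat.card Q = (P : Subgroup X).index := hQ.symm.index_eq_card.symm
  have hPQ : Nat.card P * Nat.card Q = Nat.card X := hQ.card_mul
  have hcop : Nat.Coprime (Nat.card P) (Nat.card Q) := hQc ▸ P.card_coprime_index
  have hWn : W.Normal := by
    rw [← Subgroup.normalizer_eq_top_iff]
    apply eq_top_of_index
    intro q hq hd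
    have : Fact q.Prime := ⟨hq⟩
    by_cases hqp : q = p
    · subst hqp
      obtain ⟨χ, hχ⟩ := exists_chi P.2 (W.subgroupOf P) hi
      have h1 : (P : Subgroup X) ≤ Subgroup.normalizer (W : Set X) := by
        apply le_normalizer_of_conj
        intro g hg n hw
        have h2 : (⟨n, hW hw⟩ : P) ∈ χ.ker := by rw [hχ]; exact hw
        have h3 : (⟨g, hg⟩ * ⟨n, hW hw⟩ * ⟨g, hg⟩⁻¹ : P) ∈ χ.ker :=
          (MonoidHom.normal_ker χ).conj_mem _ h2 _
        rw [hχ] at h3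
        exact h3
      exact P.not_dvd_index (hd.trans (Subgroup.index_dvd_of_le h1))
    · obtain ⟨T⟩ : Nonempty (Sylow q X) := inferInstance
      have h1 : (T : Subgroup X) ≤ Subgroup.normalizer (W : Set X) := by
        apply le_normalizer_of_conj
        intro g hg n hw
        rw [nilp_comm hX hqp T P T.2 P.2 g hg n (hW hw)]
        simpa using hw
      exact T.not_dvd_index (hd.trans (Subgroup.index_dvd_of_le h1))
  refine ⟨Q ⊔ W, le_sup_right, ?_⟩
  have hWP : Nat.card W * p = Nat.card P := by
    have := Subgroup.relIndex_mul_relIndex ⊥ W P bot_le hW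
    rwa [Subgroup.relIndex_bot_left, Subgroup.relIndex_bot_left, hi] at this
  have h1 : Nat.card (Q ⊔ W : Subgroup X) ∣ Nat.card Q * Nat.card W := by
    have := Subgroup.relIndex_mul_relIndex ⊥ Q (Q ⊔ W) bot_le le_sup_left
    rw [Subgroup.relIndex_bot_left, Subgroup.relIndex_bot_left, relIndex_sup_normal] at this
    rw [← this]
    exact mul_dvd_mul_left _ (Subgroup.relIndex_dvd_card Q W)
  have h2 : Nat.card Q * Nat.card W ∣ Nat.card (Q ⊔ W : Subgroup X) := by
    apply Nat.Coprime.mul_dvd_of_dvd_of_dvd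
    · exact (hcop.coprime_dvd_left (Subgroup.card_dvd_of_le hW)).symm
    · exact Subgroup.card_dvd_of_le le_sup_left
    · exact Subgroup.card_dvd_of_le le_sup_right
  have h3 := Nat.dvd_antisymm h1 h2
  have h4 := Subgroup.card_mul_index (Q ⊔ W)
  rw [h3, ← hPQ, ← hWP] at h4
  have h5 : 0 < Nat.card Q * Nat.card W := Nat.mul_pos Nat.card_pos Nat.card_pos
  apply Nat.eq_of_mul_eq_mul_left h5
  rw [h4]; ring

theorem isCoatom_of_prime_index {X : Type*} [Group X] (R : Subgroup X) (h : R.index.Prime) : IsCoatom R := by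
  constructor
  · rintro rfl
    rw [Subgroup.index_top] at h
    exact Nat.not_prime_one h
  · intro B hB
    have h1 := Subgroup.relIndex_mul_index hB.le
    have h2 : B.index ∣ R.index := ⟨_, by rw [← h1, mul_comm]⟩
    rcases (Nat.dvd_prime h).1 h2 with h3 | h3
    · exact Subgroup.index_eq_one.1 h3
    · exfalso
      rw [h3] at h1
      have h4 : R.relIndex B = 1 := Nat.eq_of_mul_eq_mul_right h.pos (by rw [h1, one_mul])
      exact absurd (Subgroup.relIndex_eq_one.1 h4) (not_le_of_gt hB)

theorem relIndex_sup_permutable {X : Type*} [Group X] [Finite X] (S C : Subgroup X)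
    (h : (S : Set X) * (C : Set X) = (C : Set X) * (S : Set X)) : S.relIndex (S ⊔ C) = S.relIndex C := by
  let T : Subgroup X :=
    { carrier := (C : Set X) * (S : Set X)
      one_mem' := ⟨1, C.one_mem, 1, S.one_mem, by simp⟩
      mul_mem' := by
        rintro _ _ ⟨c, hc, s, hs, rfl⟩ ⟨c', hc', s', hs', rfl⟩
        have h1 : s * c' ∈ (C : Set X) * (S : Set X) := by
          rw [← h]; exact ⟨s, hs, c', hc', rfl⟩
        obtain ⟨c2, hc2, s2, hs2, h2⟩ := h1
        refine ⟨c * c2, C.mul_mem hc hc2, s2 * s', S.mul_mem hs2 hs', ?_⟩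
        simp only [] at h2 ⊢
        calc c * c2 * (s2 * s') = c * (c2 * s2) * s' := by group
          _ = c * (s * c') * s' := by rw [h2]
          _ = c * s * (c' * s') := by group
      inv_mem' := by
        rintro _ ⟨c, hc, s, hs, rfl⟩
        rw [← h]
        exact ⟨s⁻¹, S.inv_mem hs, c⁻¹, C.inv_mem hc, by simp⟩ }
  have hT : S ⊔ C ≤ T := sup_le (fun s hs => ⟨1, C.one_mem, s, hs, by simp⟩)
    (fun c hc => ⟨c, hc, 1, S.one_mem, by simp⟩)
  symm
  apply Nat.card_eq_of_bijective (Subgroup.quotientSubgroupOfEmbeddingOfLE S (le_sup_right : C ≤ S ⊔ C))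
  refine ⟨(Subgroup.quotientSubgroupOfEmbeddingOfLE S _).injective, ?_⟩
  intro y
  obtain ⟨⟨y, hy⟩, rfl⟩ := QuotientGroup.mk_surjective y
  obtain ⟨c, hc, s, hs, hcs⟩ := hT hy
  refine ⟨QuotientGroup.mk (⟨c, hc⟩ : C), ?_⟩
  rw [Subgroup.quotientSubgroupOfEmbeddingOfLE_apply_mk]
  rw [QuotientGroup.eq, Subgroup.mem_subgroupOf]
  change c⁻¹ * y ∈ S
  have : c⁻¹ * y = s := by rw [← hcs]; simp
  rw [this]
  exact hs

theorem conj_le_sylowizer {G : Type*} [Group G] [Finite G] {τ ρ : Set ℕ} (hτρ : Disjoint τ ρ)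
    (R S Hl : Subgroup G) (hS : IsSylowizerIn τ ⊤ R S) (hHl : IsSigmaNumber ρ (Nat.card Hl))
    (hperm : CPermutable S Hl) : ∃ x : G, conjSubgroup x Hl ≤ S := by
  obtain ⟨x, hx⟩ := hperm
  refine ⟨x⁻¹, ?_⟩
  obtain ⟨_, ⟨hRS, hRτ, hRi⟩, hmax⟩ := hS
  have hcard : Nat.card (conjSubgroup x⁻¹ Hl) = Nat.card Hl :=
    Subgroup.card_map_of_injective (MulAut.conj x⁻¹).injective
  have h1 := hmax (S ⊔ conjSubgroup x⁻¹ Hl) le_top ⟨hRS.trans le_sup_left, hRτ, ?_⟩ le_sup_left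
  · rw [← h1]; exact le_sup_right
  · intro q hq hqτ hd
    rw [← Subgroup.relIndex_mul_relIndex R S _ hRS le_sup_left, relIndex_sup_permutable _ _ hx] at hd
    rcases hq.dvd_mul.1 hd with h | h
    · exact hRi q hq hqτ h
    · have h2 := h.trans (Subgroup.relIndex_dvd_card _ _)
      rw [hcard] at h2
      exact Set.disjoint_left.1 hτρ hqτ (hHl q hq h2)

theorem index_conj {G : Type*} [Group G] (x : G) (H : Subgroup G) : (conjSubgroup x H).index = H.index :=
  Subgroup.index_map_equiv H (MulAut.conj x)

theorem cond_of_hyp {G : Type*} [Group G] [Finite G] {I : Type*} (σ : I → Set ℕ)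
    (hσ : IsPrimePartition σ)
    (t : ℕ) (idx : Fin t → I) (H : Fin t → Subgroup G)
    (hinj : Function.Injective idx)
    (hcomplete : ∀ i : I, SigmaMem σ G i ↔ ∃ k, idx k = i)
    (hHall : ∀ k, IsHallSigmaIn (σ (idx k)) (H k) ⊤)
    (hnilp : ∀ k, Group.IsNilpotent (H k))
    (E : Subgroup G) [E.Normal]
    (hmax : ∀ k, SigmaMem σ E (idx k) → ¬ IsCyclic ↥(H k ⊓ E) →
      ∀ M : Subgroup ↥(H k ⊓ E), IsCoatom M →
        ∃ S : Subgroup G, IsSylowizerIn (σ (idx k)) ⊤ (M.map (H k ⊓ E).subtype) S ∧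
          ∀ l, CPermutable S (H l)) : Cond E := by
  intro p hpp
  have hp : Fact p.Prime := ⟨hpp⟩
  by_cases hpE : p ∣ Nat.card E
  swap
  · refine ⟨⊥, bot_le, IsPGroup.of_bot, ?_, Or.inl inferInstance⟩
    rw [Subgroup.relIndex_bot_left]
    exact hpE
  obtain ⟨i, hi⟩ := hσ.2.2.1 p hpp
  obtain ⟨k, rfl⟩ := (hcomplete i).1 ⟨p, hi, hpE.trans (Subgroup.card_subgroup_dvd_card E)⟩
  obtain ⟨-, hHτ, hHi⟩ := hHall k
  rw [Subgroup.relIndex_top_right] at hHi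
  obtain ⟨K, hK⟩ : ∃ K, K = H k ⊓ E := ⟨_, rfl⟩
  have hmaxk := hmax k ⟨p, hi, hpE⟩
  rw [← hK] at hmaxk
  have hKH : K ≤ H k := hK ▸ inf_le_left
  have hKE : K ≤ E := hK ▸ inf_le_right
  have hKi : ∀ q : ℕ, q.Prime → q ∈ σ (idx k) → ¬ q ∣ K.relIndex E := by
    intro q hq hqτ hd
    apply hHi q hq hqτ
    rw [hK, Subgroup.inf_relIndex_right] at hd
    have := relIndex_dvd_of_normal' (H k) E ⊤ le_top
    rw [Subgroup.relIndex_top_right] at this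
    exact hd.trans this
  have hKn : Group.IsNilpotent K := by
    have := hnilp k
    exact (Group.isNilpotent_congr (Subgroup.subgroupOfEquivOfLe hKH)).mp (Subgroup.isNilpotent _)
  obtain ⟨P0⟩ : Nonempty (Sylow p K) := inferInstance
  obtain ⟨P, hP⟩ : ∃ P, P = (P0 : Subgroup K).map K.subtype := ⟨_, rfl⟩
  have hPK : P ≤ K := hP ▸ Subgroup.map_subtype_le _
  have hPp : IsPGroup p P := hP ▸ P0.2.map _
  have hP0 : P.subgroupOf K = P0 := by
    rw [hP]
    exact Subgroup.comap_map_eq_self_of_injective K.subtype_injective _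
  refine ⟨P, hPK.trans hKE, hPp, ?_, ?_⟩
  · rw [← Subgroup.relIndex_mul_relIndex P K E hPK hKE, hpp.dvd_mul]
    rintro (h | h)
    · rw [hP, relIndex_map_subtype'] at h
      exact P0.not_dvd_index h
    · exact hKi p hpp hi h
  by_cases hcyc : IsCyclic K
  · left
    exact isCyclic_of_injective (Subgroup.inclusion hPK) (Subgroup.inclusion_injective hPK)
  right
  intro P1 hP1 hP1i
  obtain ⟨R, hR1, hR2⟩ := nilp_index_p hKn P0 (P1.subgroupOf K)
    (by rw [← hP0]; exact Subgroup.comap_mono hP1)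
    (by rw [← hP0, Subgroup.relIndex_subgroupOf hPK, hP1i])
  obtain ⟨S, hS, hperm⟩ := hmaxk hcyc R (isCoatom_of_prime_index R (hR2 ▸ hpp))
  have hP1R : P1 ≤ R.map K.subtype := by
    intro x hx
    exact ⟨⟨x, hPK (hP1 hx)⟩, hR1 hx, rfl⟩
  have hRK : (R.map K.subtype).relIndex K = p := by rw [relIndex_map_subtype', hR2]
  have hRKle : R.map K.subtype ≤ K := Subgroup.map_subtype_le _
  have hSi : IsSigmaNumber (σ (idx k)) S.index := by
    intro q hq hd
    obtain ⟨j, hj⟩ := hσ.2.2.1 q hq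
    obtain ⟨l, rfl⟩ := (hcomplete j).1 ⟨q, hj, hd.trans (Subgroup.index_dvd_card S)⟩
    by_cases hlk : l = k
    · exact hlk ▸ hj
    · exfalso
      have hdis : Disjoint (σ (idx k)) (σ (idx l)) := hσ.2.2.2 _ _ (fun h => hlk (hinj h).symm)
      obtain ⟨x, hx⟩ := conj_le_sylowizer hdis _ S (H l) hS (hHall l).2.1 (hperm l)
      have h1 := hd.trans (Subgroup.index_dvd_of_le hx)
      rw [index_conj] at h1
      have h2 := (hHall l).2.2 q hq hj
      rw [Subgroup.relIndex_top_right] at h2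
      exact h2 h1
  obtain ⟨-, ⟨hRS, hRτ, hRi⟩, -⟩ := hS
  refine ⟨S, hP1R.trans hRS, ?_, ?_⟩
  · have h1 := Subgroup.relIndex_mul_relIndex (R.map K.subtype) (S ⊓ E) E
      (le_inf hRS (hRKle.trans hKE)) inf_le_right
    have h2 := Subgroup.relIndex_mul_relIndex (R.map K.subtype) K E hRKle hKE
    rw [hRK, ← h1, Subgroup.inf_relIndex_right] at h2
    have h3 : S.relIndex E ∣ S.index := by
      have := relIndex_dvd_of_normal' S E ⊤ le_top
      rwa [Subgroup.relIndex_top_right] at this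
    have h4 := Subgroup.relIndex_mul_relIndex (R.map K.subtype) (S ⊓ E) S
      (le_inf hRS (hRKle.trans hKE)) inf_le_left
    apply Nat.dvd_antisymm
    · have hcop : Nat.Coprime (S.relIndex E) (K.relIndex E) := by
        apply Nat.coprime_of_dvd
        intro q hq hd1 hd2
        exact hKi q hq (hSi q hq (hd1.trans h3)) hd2
      apply hcop.dvd_of_dvd_mul_right
      rw [h2]
      exact dvd_mul_left _ _
    · have h5 : p ∣ (R.map K.subtype).relIndex (S ⊓ E) * S.relIndex E := h2 ▸ dvd_mul_right _ _
      rcases hpp.dvd_mul.1 h5 with h | h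
      · exact absurd (h4 ▸ h.mul_right _) (hRi p hpp hi)
      · exact h
  · intro q hq hd
    have : Fact q.Prime := ⟨hq⟩
    by_contra hqp
    have hqτ : q ∈ σ (idx k) := hSi q hq (hd.trans (Subgroup.index_dvd_of_le le_sup_left))
    obtain ⟨Q⟩ : Nonempty (Sylow q (H k)) := inferInstance
    have h1 : (Q : Subgroup (H k)).map (H k).subtype ≤ Subgroup.centralizer (P : Set G) := by
      rintro _ ⟨x, hx, rfl⟩
      rw [Subgroup.mem_centralizer_iff]
      intro y hy
      have h2 := nilp_comm (hnilp k) hqp (Q : Subgroup (H k)) (P.subgroupOf (H k)) Q.2 hPp.comap_subtype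
        x hx ⟨y, hKH (hPK hy)⟩ hy
      exact (congrArg Subtype.val h2).symm
    have h2 := hd.trans (Subgroup.index_dvd_of_le (h1.trans le_sup_right))
    rw [← Subgroup.relIndex_mul_index (Subgroup.map_subtype_le (Q : Subgroup (H k))), hq.dvd_mul,
      relIndex_map_subtype'] at h2
    rcases h2 with h | h
    · exact Q.not_dvd_index h
    · exact hHi q hq hqτ h

def CStep {G : Type*} [Group G] (A B : Subgroup G) : Prop :=
  A.Normal ∧ B.Normal ∧ A ≤ B ∧ ∃ g ∈ B, A ⊔ Subgroup.zpowers g = B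

theorem cstep_of_pstep {G : Type*} [Group G] {A B : Subgroup G} (h : PStep A B) : CStep A B := by
  obtain ⟨h1, h2, h3, h4⟩ := h
  refine ⟨h1, h2, h3, ?_⟩
  have hne : ¬ B ≤ A := fun h => by
    rw [Subgroup.relIndex_eq_one.2 h] at h4
    exact Nat.not_prime_one h4
  obtain ⟨g, hgB, hgA⟩ := Set.not_subset.1 hne
  have hle : A ⊔ Subgroup.zpowers g ≤ B := sup_le h3 (Subgroup.zpowers_le.2 hgB)
  refine ⟨g, hgB, le_antisymm hle ?_⟩
  have h5 := Subgroup.relIndex_mul_relIndex A (A ⊔ Subgroup.zpowers g) B le_sup_left hle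
  rw [← h5] at h4
  rcases Nat.prime_mul_iff.1 h4 with ⟨_, h⟩ | ⟨_, h⟩
  · exact Subgroup.relIndex_eq_one.1 h
  · exfalso
    apply hgA
    exact Subgroup.relIndex_eq_one.1 h (Subgroup.mem_sup_right (Subgroup.mem_zpowers g))

theorem cstep_comap {G : Type*} [Group G] (N : Subgroup G) [N.Normal] {A B : Subgroup (G ⧸ N)} (h : CStep A B) :
    CStep (A.comap (QuotientGroup.mk' N)) (B.comap (QuotientGroup.mk' N)) := by
  obtain ⟨h1, h2, h3, g, hg, h4⟩ := h
  obtain ⟨x, rfl⟩ := QuotientGroup.mk'_surjective N g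
  refine ⟨h1.comap _, h2.comap _, Subgroup.comap_mono h3, x, hg, ?_⟩
  have h5 : (A.comap (QuotientGroup.mk' N) ⊔ Subgroup.zpowers x).map (QuotientGroup.mk' N) = B := by
    rw [Subgroup.map_sup, Subgroup.map_comap_eq_self_of_surjective (QuotientGroup.mk'_surjective N),
      MonoidHom.map_zpowers, h4]
  have h6 : (QuotientGroup.mk' N).ker ≤ A.comap (QuotientGroup.mk' N) ⊔ Subgroup.zpowers x := by
    refine le_trans ?_ le_sup_left
    rw [← MonoidHom.comap_bot]
    exact Subgroup.comap_mono bot_le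
  rw [← h5, Subgroup.comap_map_eq, sup_eq_left.2 h6]

theorem chain_of_supersoluble {X : Type*} [Group X] (h : IsSupersoluble X) :
    Relation.ReflTransGen CStep (⊥ : Subgroup X) ⊤ := by
  obtain ⟨n, c, h0, h1, hn, hle, hg⟩ := h
  have key : ∀ k : Fin (n + 1), Relation.ReflTransGen CStep (⊥ : Subgroup X) (c k) := by
    intro k
    induction k using Fin.induction with
    | zero => rw [h0]
    | succ k ih => exact ih.tail ⟨hn _, hn _, hle k, hg k⟩
  rw [← h1]
  exact key _

theorem supersoluble_of_chain {X : Type*} [Group X]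
    (h : Relation.ReflTransGen CStep (⊥ : Subgroup X) ⊤) : IsSupersoluble X := by
  have key : ∀ B : Subgroup X, Relation.ReflTransGen CStep (⊥ : Subgroup X) B →
      ∃ (n : ℕ) (f : ℕ → Subgroup X), f 0 = ⊥ ∧ f n = B ∧ (∀ k, (f k).Normal) ∧
        ∀ k < n, CStep (f k) (f (k + 1)) := by
    intro B hB
    induction hB with
    | refl => exact ⟨0, fun _ => ⊥, rfl, rfl, fun _ => inferInstance, fun k hk => absurd hk (by omega)⟩
    | tail _ h ih =>
      rename_i A C _
      obtain ⟨n, f, h0, h1, h2, h3⟩ := ih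
      refine ⟨n + 1, fun k => if k ≤ n then f k else C, ?_, ?_, ?_, ?_⟩
      · simp [h0]
      · simp
      · intro k
        by_cases hk : k ≤ n
        · simp only [hk, if_true]; exact h2 k
        · simp only [hk, if_false]; exact h.2.1
      · intro k hk
        have hk' : k ≤ n := by omega
        by_cases hk2 : k + 1 ≤ n
        · simp only [hk', hk2, if_true]; exact h3 k (by omega)
        · have : k = n := by omega
          subst this
          simp only [le_refl, hk2, if_true, if_false]
          rw [h1]; exact h
  obtain ⟨n, f, h0, h1, h2, h3⟩ := key _ h
  refine ⟨n, fun k => f k.val, h0, h1, fun k => h2 _, fun k => (h3 k k.2).2.2.1, fun k => (h3 k k.2).2.2.2⟩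


/-- Let `G` be a `σ`-full group of Sylow type with a complete Hall `σ`-set
`{H 1, …, H t}` of nilpotent subgroups and `E ⊴ G` with `G/E` supersoluble. If for every
`σᵢ ∈ σ(E)` with `H i ⊓ E` non-cyclic, every maximal subgroup of `H i ⊓ E` has a
`σᵢ`-sylowizer in `G` that is `c`-permutable with every member of the Hall `σ`-set,
then `G` is supersoluble. -/
theorem stmt_8 {G : Type*} [Group G] [Finite G] {I : Type*} (σ : I → Set ℕ)
    (hσ : IsPrimePartition σ) (hfull : SigmaFullSylowType σ G)
    (t : ℕ) (idx : Fin t → I) (H : Fin t → Subgroup G)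
    (hinj : Function.Injective idx)
    (hcomplete : ∀ i : I, SigmaMem σ G i ↔ ∃ k, idx k = i)
    (hHall : ∀ k, IsHallSigmaIn (σ (idx k)) (H k) ⊤)
    (hnilp : ∀ k, Group.IsNilpotent (H k))
    (E : Subgroup G) [E.Normal]
    (hGE : IsSupersoluble (G ⧸ E))
    (hmax : ∀ k, SigmaMem σ E (idx k) → ¬ IsCyclic ↥(H k ⊓ E) →
      ∀ M : Subgroup ↥(H k ⊓ E), IsCoatom M →
        ∃ S : Subgroup G, IsSylowizerIn (σ (idx k)) ⊤ (M.map (H k ⊓ E).subtype) S ∧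
          ∀ l, CPermutable S (H l)) :
    IsSupersoluble G := by
  have h1 := main_chain _ E inferInstance
    (cond_of_hyp σ hσ t idx H hinj hcomplete hHall hnilp E hmax) le_rfl
  have h2 := Relation.ReflTransGen.mono (p := CStep) (fun _ _ h => cstep_of_pstep h) _ _ h1
  have h3 := Relation.ReflTransGen.lift (p := CStep) (fun A : Subgroup (G ⧸ E) => A.comap (QuotientGroup.mk' E))
    (fun _ _ h => cstep_comap E h) _ _ (chain_of_supersoluble hGE)
  rw [Function.onFun, MonoidHom.comap_bot, QuotientGroup.ker_mk', Subgroup.comap_top] at h3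
  exact supersoluble_of_chain (h2.trans h3)
end

section
/- Let σ = {σ_i | i ∈ I} be a partition of the set of all primes, G a finite σ-full group of Sylow type with a complete Hall σ-set 𝓗 = {H_1, …, H_t} such that each H_i is a nilpotent σ_i-subgroup, and E a normal subgroup of G. Suppose that for every σ_i ∈ σ(E), whenever H_i ∩ E is non-cyclic, every maximal subgroup of H_i ∩ E has a σ_i-sylowizer in G that is c-permutable in G with every member of 𝓗. Then E is supersoluble. -/
open Pointwise

section Helpers

open Subgroup

theorem relIndex_sup_of_normal {G : Type*} [Group G] [Finite G] (P K : Subgroup G) [K.Normal] :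
    P.relIndex (P ⊔ K) = P.relIndex K := by
  have h1 := relIndex_mul_relIndex (P ⊓ K) P (P ⊔ K) inf_le_left le_sup_left
  have h2 := relIndex_mul_relIndex (P ⊓ K) K (P ⊔ K) inf_le_right le_sup_right
  rw [relIndex_sup_right, inf_relIndex_right] at h2
  rw [inf_relIndex_left] at h1
  have h3 : K.relIndex P ≠ 0 := by
    have := relIndex_dvd_card K P
    intro h
    rw [h] at this
    exact Nat.card_pos.ne' (zero_dvd_iff.mp this)
  apply Nat.eq_of_mul_eq_mul_left (Nat.pos_of_ne_zero h3)
  rw [h1, ← h2, mul_comm]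

theorem relIndex_dvd_index_of_normal' {G : Type*} [Group G] [Finite G] (P K : Subgroup G)
    [K.Normal] : P.relIndex K ∣ P.index := by
  rw [← relIndex_sup_of_normal P K]
  exact relIndex_dvd_index_of_le le_sup_left

/-- The arithmetic condition extracted from the hypotheses. -/
def Good (G : Type*) [Group G] : Prop :=
  ∀ (p : ℕ) [Fact p.Prime] (P : Sylow p G), ¬ IsCyclic P →
    ∀ Q : Subgroup G, Q ≤ P → Q.relIndex P = p → ∃ T : Subgroup G, Q ≤ T ∧ T.index = p

theorem IsSupersoluble.of_quotient {G : Type*} [Group G] (N : Subgroup G) [N.Normal]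
    (hN : ∃ g : G, N = zpowers g) (h : IsSupersoluble (G ⧸ N)) : IsSupersoluble G := by
  obtain ⟨g, hg⟩ := hN
  obtain ⟨n, c, h0, h1, hnor, hle, hcyc⟩ := h
  refine ⟨n + 1, Fin.cons ⊥ (fun k => (c k).comap (QuotientGroup.mk' N)), rfl, ?_, ?_, ?_, ?_⟩
  · rw [← Fin.succ_last, Fin.cons_succ, h1, comap_top]
  · intro k
    refine Fin.cases ?_ ?_ k
    · rw [Fin.cons_zero]; infer_instance
    · intro k
      rw [Fin.cons_succ]
      have := hnor k
      infer_instance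
  · intro k
    refine Fin.cases ?_ ?_ k
    · rw [Fin.castSucc_zero, Fin.cons_zero]; exact bot_le
    · intro k
      rw [← Fin.succ_castSucc, Fin.cons_succ, Fin.cons_succ]
      exact comap_mono (hle k)
  · intro k
    refine Fin.cases ?_ ?_ k
    · refine ⟨g, ?_, ?_⟩
      · rw [Fin.cons_succ, h0]
        simp [MonoidHom.comap_bot, hg]
      · rw [Fin.castSucc_zero, Fin.cons_zero, Fin.cons_succ, h0, MonoidHom.comap_bot,
          QuotientGroup.ker_mk', bot_sup_eq, hg]
    · intro k
      obtain ⟨a, ha, hk⟩ := hcyc k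
      obtain ⟨b, rfl⟩ := QuotientGroup.mk'_surjective N a
      refine ⟨b, ?_, ?_⟩
      · rw [Fin.cons_succ]; exact ha
      · rw [← Fin.succ_castSucc, Fin.cons_succ, Fin.cons_succ, ← hk, ← MonoidHom.map_zpowers]
        rw [← comap_sup_eq _ _ _ (QuotientGroup.mk'_surjective N), comap_map_eq,
          QuotientGroup.ker_mk', sup_comm (zpowers b), ← sup_assoc]
        congr 1
        symm
        apply sup_of_le_left
        conv_lhs => rw [← QuotientGroup.ker_mk' N]
        exact ker_le_comap _ _

theorem Good.quotient {G : Type*} [Group G] [Finite G] (hG : Good G) (K : Subgroup G) [K.Normal] :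
    Good (G ⧸ K) := by
  intro p hp P' hP' Q' hQ' hidx
  set f := QuotientGroup.mk' K with hf
  have hs : Function.Surjective f := QuotientGroup.mk'_surjective K
  obtain ⟨P, rfl⟩ := Sylow.mapSurjective_surjective hs p P'
  have hco : ((P.mapSurjective hs : Sylow p (G ⧸ K)) : Subgroup (G ⧸ K)) = (P : Subgroup G).map f := rfl
  have hPc : ¬ IsCyclic P := by
    intro h
    apply hP'
    exact isCyclic_of_surjective _ (f.subgroupMap_surjective (P : Subgroup G))
  obtain ⟨T, hQT, hT⟩ := hG p P hPc (Q'.comap f ⊓ P) inf_le_right (by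
    rw [inf_relIndex_right, relIndex_comap]; exact hidx)
  have hKT : K ≤ T := by
    have h1 : T.relIndex K ∣ p := hT ▸ relIndex_dvd_index_of_normal' T K
    rcases (Nat.dvd_prime hp.out).mp h1 with h | h
    · exact relIndex_eq_one.mp h
    · exfalso
      have h2 : (P : Subgroup G) ⊓ K ≤ T := by
        refine le_trans ?_ hQT
        refine le_inf ?_ inf_le_left
        refine le_trans inf_le_right ?_
        conv_lhs => rw [← QuotientGroup.ker_mk' K]
        exact ker_le_comap _ _
      have h3 : T.relIndex K ∣ (P : Subgroup G).relIndex K := by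
        rw [← inf_relIndex_right (P : Subgroup G) K]
        exact relIndex_dvd_of_le_left K h2
      rw [h] at h3
      exact P.not_dvd_index (h3.trans (relIndex_dvd_index_of_normal' _ K))
  refine ⟨T.map f, ?_, ?_⟩
  · intro x hx
    obtain ⟨y, hy, rfl⟩ := hQ' hx
    exact mem_map_of_mem f (hQT ⟨hx, hy⟩)
  · rw [index_map_eq _ hs (by rw [QuotientGroup.ker_mk']; exact hKT), hT]

theorem Good.normal {G : Type*} [Group G] [Finite G] (hG : Good G) (K : Subgroup G) [K.Normal]
    (hK : (Nat.card K).Coprime K.index) : Good K := by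
  intro q hq Q hQ Q1 hQ1 hidx
  have hqK : q ∣ Nat.card K := by
    by_contra h
    apply hQ
    have : Nat.card Q = 1 := by
      rw [Q.card_eq_multiplicity, Nat.factorization_eq_zero_of_not_dvd h, pow_zero]
    have := (Nat.card_eq_one_iff_unique.mp this).1
    infer_instance
  have hqi : ¬ q ∣ K.index := fun h =>
    hq.out.one_lt.ne' (Nat.dvd_one.mp (hK ▸ Nat.dvd_gcd hqK h))
  have hpg : IsPGroup q ((Q : Subgroup K).map K.subtype) := Q.isPGroup'.map _
  let P : Sylow q G := hpg.toSylow (by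
    rw [index_map_subtype, hq.out.dvd_mul]
    exact not_or.mpr ⟨Q.not_dvd_index, hqi⟩)
  have hP : (P : Subgroup G) = (Q : Subgroup K).map K.subtype := rfl
  obtain ⟨T, h1, h2⟩ := hG q P (by
    intro h
    apply hQ
    exact (((Q : Subgroup K).equivMapOfInjective _ K.subtype_injective).isCyclic).mpr h)
    (Q1.map K.subtype) (map_mono hQ1) (by
      rw [hP, relIndex_map_map_of_injective _ _ K.subtype_injective, hidx])
  refine ⟨T.subgroupOf K, ?_, ?_⟩
  · intro x hx
    exact h1 (mem_map_of_mem _ hx)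
  · change T.relIndex K = q
    rw [← relIndex_sup_of_normal]
    have h3 := relIndex_mul_index (le_sup_left : T ≤ T ⊔ K)
    have h4 : (T ⊔ K).index = 1 := by
      have h5 : (T ⊔ K).index ∣ q := h2 ▸ index_dvd_of_le le_sup_left
      rcases (Nat.dvd_prime hq.out).mp h5 with h | h
      · exact h
      · exact absurd (h ▸ index_dvd_of_le (le_sup_right : K ≤ T ⊔ K)) hqi
    rw [← h2, ← h3, h4, mul_one]

/-- A proper subgroup of a finite `p`-group lies in a subgroup of index `p`. -/
theorem exists_index_prime {P : Type*} [Group P] [Finite P] {p : ℕ} [hp : Fact p.Prime]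
    (hP : IsPGroup p P) (F : Subgroup P) (hF : F ≠ ⊤) : ∃ Q : Subgroup P, F ≤ Q ∧ Q.index = p := by
  obtain ⟨n, hn⟩ := IsPGroup.iff_card.mp hP
  obtain ⟨m, hm⟩ := IsPGroup.iff_card.mp (hP.to_subgroup F)
  have hmn : m < n := by
    have h1 : Nat.card F ∣ Nat.card P := card_subgroup_dvd_card F
    rw [hm, hn] at h1
    refine lt_of_le_of_ne ((Nat.pow_dvd_pow_iff_le_right hp.out.one_lt).mp h1) ?_
    rintro rfl
    exact hF (eq_top_of_card_eq F (hm.trans hn.symm))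
  obtain ⟨k, rfl⟩ : ∃ k, n = k + 1 := ⟨n - 1, by omega⟩
  obtain ⟨Q, hQ, hFQ⟩ := Sylow.exists_subgroup_card_pow_prime_le p
    (hn ▸ pow_dvd_pow p (Nat.le_succ k)) F hm (by omega)
  refine ⟨Q, hFQ, ?_⟩
  have := Q.card_mul_index
  rw [hQ, hn, pow_succ] at this
  exact Nat.eq_of_mul_eq_mul_left (pow_pos hp.out.pos k) this

/-- A subgroup of index `p` in a finite `p`-group is normal. -/
theorem normal_of_index_prime {P : Type*} [Group P] [Finite P] {p : ℕ} [hp : Fact p.Prime]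
    (hP : IsPGroup p P) (Q : Subgroup P) (hQ : Q.index = p) : Q.Normal := by
  apply normal_of_index_eq_minFac_card
  obtain ⟨n, hn⟩ := IsPGroup.iff_card.mp hP
  have : n ≠ 0 := by
    rintro rfl
    have := Q.index_dvd_card
    rw [hn, hQ, pow_zero] at this
    exact hp.out.one_lt.ne' (Nat.dvd_one.mp this)
  rw [hQ, hn, Nat.Prime.pow_minFac hp.out this]
/-- A nontrivial normal subgroup of a finite `p`-group has an invariant nontrivial character. -/
theorem exists_invariant_hom {P : Type*} [Group P] [Finite P] {p : ℕ} [hp : Fact p.Prime]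
    (hP : IsPGroup p P) (D : Subgroup P) [D.Normal] (hD : D ≠ ⊥) :
    ∃ φ : D →* Multiplicative (ZMod p), φ ≠ 1 ∧
      ∀ (y : P) (d : D), φ (MulAut.conjNormal y d) = φ d := by
  let act : MulAction P (D →* Multiplicative (ZMod p)) :=
    { smul := fun y f => f.comp (MulAut.conjNormal (H := D) y⁻¹).toMonoidHom
      one_smul := fun f => by
        ext d
        change f (MulAut.conjNormal (H := D) (1 : P)⁻¹ d) = f d
        simp
      mul_smul := fun y z f => by
        ext d
        change f (MulAut.conjNormal (H := D) (y * z)⁻¹ d) =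
          f (MulAut.conjNormal (H := D) z⁻¹ (MulAut.conjNormal (H := D) y⁻¹ d))
        rw [mul_inv_rev, map_mul]; rfl }
  have hsmul : ∀ (y : P) (f : D →* Multiplicative (ZMod p)) (d : D),
      (y • f) d = f (MulAut.conjNormal (H := D) y⁻¹ d) := fun _ _ _ => rfl
  have hfin : Finite (D →* Multiplicative (ZMod p)) :=
    Finite.of_injective (fun f => (f : D → Multiplicative (ZMod p))) DFunLike.coe_injective
  have hone : (1 : D →* Multiplicative (ZMod p)) ∈
      MulAction.fixedPoints P (D →* Multiplicative (ZMod p)) := by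
    intro y
    ext d
    rfl
  -- a nontrivial character
  have hnt : ∃ f : D →* Multiplicative (ZMod p), f ≠ 1 := by
    have hDp := hP.to_subgroup D
    have hne : (⊥ : Subgroup D) ≠ ⊤ := by
      intro h
      apply hD
      have := Subgroup.subsingleton_iff.mp (subsingleton_of_bot_eq_top h)
      exact (Subgroup.eq_bot_iff_forall _).mpr fun x hx =>
        congrArg Subtype.val (Subsingleton.elim (⟨x, hx⟩ : D) 1)
    obtain ⟨Q, -, hQ⟩ := exists_index_prime hDp ⊥ hne
    have hQn := normal_of_index_prime hDp Q hQ
    have hc1 : Nat.card (D ⧸ Q) = p := hQ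
    have hc2 : Nat.card (Multiplicative (ZMod p)) = p := by
      rw [Nat.card_congr Multiplicative.toAdd, Nat.card_zmod]
    let e : D ⧸ Q ≃* Multiplicative (ZMod p) := mulEquivOfPrimeCardEq hc1 hc2
    refine ⟨e.toMonoidHom.comp (QuotientGroup.mk' Q), ?_⟩
    intro h
    have htop : Q = ⊤ := by
      rw [eq_top_iff]
      intro d _
      have h1 : e (QuotientGroup.mk' Q d) = 1 := DFunLike.congr_fun h d
      rw [map_eq_one_iff e e.injective] at h1
      exact (QuotientGroup.eq_one_iff d).mp h1
    rw [htop, index_top] at hQ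
    exact hp.out.one_lt.ne hQ
  obtain ⟨f, hf⟩ := hnt
  have hdvd : p ∣ Nat.card (D →* Multiplicative (ZMod p)) := by
    have hfp : f ^ p = 1 := by
      ext d
      rw [MonoidHom.pow_apply, MonoidHom.one_apply]
      change p • (Multiplicative.toAdd (f d)) = 0
      simp
    have := orderOf_eq_prime hfp hf
    exact this.symm.dvd.trans (_root_.orderOf_dvd_natCard f)
  obtain ⟨φ, hφ, hne⟩ := hP.exists_fixed_point_of_prime_dvd_card_of_fixed_point _ hdvd hone
  refine ⟨φ, hne.symm, fun y d => ?_⟩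
  have := DFunLike.congr_fun (hφ y⁻¹) d
  rw [hsmul, inv_inv] at this
  exact this

theorem transfer_eq_pow_of_invariant {G : Type*} [Group G] [Finite G] {H : Subgroup G} {A : Type*}
    [CommGroup A] (φ : H →* A) (g : G) (a : A)
    (h : ∀ t : G, ∃ ht : t⁻¹ * g * t ∈ H, φ ⟨t⁻¹ * g * t, ht⟩ = a) :
    MonoidHom.transfer φ g = a ^ H.index := by
  classical
  let T : H.LeftTransversal := default
  rw [MonoidHom.transfer_def φ T g, leftTransversals.diff]
  let _ := H.fintypeQuotientOfFiniteIndex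
  rw [index_eq_card, Nat.card_eq_fintype_card, ← Finset.card_univ, ← Finset.prod_const]
  · refine Finset.prod_congr rfl ?_
    intro q _
    have hq : g⁻¹ • q = q := by
      induction q using QuotientGroup.induction_on with
      | H t =>
        rw [MulAction.Quotient.smul_mk, QuotientGroup.eq]
        obtain ⟨ht, -⟩ := h t
        simpa [mul_assoc] using ht
    obtain ⟨ht, h2⟩ := h (T.2.leftQuotientEquiv q : G)
    rw [← h2]
    congr 1
    apply Subtype.ext
    change _ * _ = _
    rw [Subgroup.smul_apply_eq_smul_apply_inv_smul, hq, smul_eq_mul]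
    exact (mul_assoc _ _ _).symm

/-- The key case of the theorem of Tate on normal `p`-complements. -/
theorem tate_s9 {G : Type*} [Group G] [Finite G] {p : ℕ} [hp : Fact p.Prime] (P : Sylow p G)
    (K : Subgroup G) [K.Normal] (hPK : (P : Subgroup G) ⊔ K = ⊤)
    (hK : ∀ f : K →* Multiplicative (ZMod p), f = 1)
    (hΦ : ∀ Q : Subgroup P, Q.index = p → K.subgroupOf P ≤ Q) : K.subgroupOf P = ⊥ := by
  by_contra hD
  set D : Subgroup P := K.subgroupOf P with hDdef
  obtain ⟨φ, hφ1, hφ⟩ := exists_invariant_hom P.isPGroup' D hD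
  let X : Subgroup (G × P) := MonoidHom.eqLocus
    ((QuotientGroup.mk' K).comp (MonoidHom.fst G P))
    ((QuotientGroup.mk' K).comp ((P : Subgroup G).subtype.comp (MonoidHom.snd G P)))
  have hX : ∀ (g : G) (y : P), (g, y) ∈ X ↔ g⁻¹ * (y : G) ∈ K := by
    intro g y
    exact QuotientGroup.eq
  let π : X →* G := (MonoidHom.fst G P).comp X.subtype
  have hπ : Function.Surjective π := by
    intro g
    have hg : g ∈ (P : Subgroup G) ⊔ K := hPK ▸ mem_top g
    obtain ⟨y, hy, k, hk, rfl⟩ := Subgroup.mem_sup_of_normal_right.mp hg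
    refine ⟨⟨(y * k, ⟨y, hy⟩), (hX _ _).mpr ?_⟩, rfl⟩
    simpa using hk
  let W : Subgroup X := (P : Subgroup G).comap π
  have hWi : W.index = (P : Subgroup G).index := index_comap_of_surjective _ hπ
  have hWD : ∀ w : W, (⟨(w : X).1.1, w.2⟩ : P)⁻¹ * (w : X).1.2 ∈ D := fun w =>
    (hX _ _).mp (w : X).2
  let τ : W →* Multiplicative (ZMod p) := MonoidHom.mk'
    (fun w => φ ⟨(⟨(w : X).1.1, w.2⟩ : P)⁻¹ * (w : X).1.2, hWD w⟩) (by
      intro a b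
      rw [← hφ ((⟨(b : X).1.1, b.2⟩ : P)⁻¹) ⟨(⟨(a : X).1.1, a.2⟩ : P)⁻¹ * (a : X).1.2, hWD a⟩,
        ← map_mul]
      congr 1
      apply Subtype.ext
      apply Subtype.ext
      simp [mul_assoc])
  let V := MonoidHom.transfer τ
  have h1D : ∀ d : D, ((1 : G), (d : P)) ∈ X := fun d => (hX _ _).mpr (by
    simpa using (mem_subgroupOf.mp d.2))
  have hV : ∀ d : D, V ⟨(1, d), h1D d⟩ = φ d ^ (P : Subgroup G).index := by
    intro d
    rw [← hWi]
    apply transfer_eq_pow_of_invariant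
    intro t
    have ht : t⁻¹ * ⟨(1, (d : P)), h1D d⟩ * t ∈ W := by
      change (t.1.1)⁻¹ * 1 * t.1.1 ∈ (P : Subgroup G)
      simp
    refine ⟨ht, ?_⟩
    rw [← hφ (t.1.2)⁻¹ d]
    change φ _ = φ _
    congr 1
    apply Subtype.ext
    apply Subtype.ext
    simp [mul_assoc]
  let ι : K →* X := MonoidHom.mk' (fun k => ⟨((k : G), 1), (hX _ _).mpr (by simp)⟩) (by
    intro a b
    apply Subtype.ext
    simp)
  have hVK : ∀ k : K, V (ι k) = 1 := fun k => DFunLike.congr_fun (hK (V.comp ι)) k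
  let δ : P →* X := MonoidHom.mk' (fun y => ⟨((y : G), y), (hX _ _).mpr (by simp)⟩) (by
    intro a b
    apply Subtype.ext
    simp)
  let χ : P →* Multiplicative (ZMod p) := V.comp δ
  have hχ : ∀ d : D, χ d = φ d ^ (P : Subgroup G).index := by
    intro d
    rw [← hV d, ← one_mul (V _), ← hVK ⟨((d : P) : G), mem_subgroupOf.mp d.2⟩, ← map_mul]
    change V _ = V _
    congr 1
    apply Subtype.ext
    simp [ι, δ]
  obtain ⟨d, hd⟩ : ∃ d, φ d ≠ 1 := by
    by_contra h
    push Not at h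
    exact hφ1 (MonoidHom.ext h)
  have hc2 : Nat.card (Multiplicative (ZMod p)) = p := by
    rw [Nat.card_congr Multiplicative.toAdd, Nat.card_zmod]
  have hχd : χ d ≠ 1 := by
    rw [hχ d]
    intro h
    have h1 := orderOf_dvd_of_pow_eq_one h
    have h2 : orderOf (φ d) ∣ p := (_root_.orderOf_dvd_natCard (φ d)).trans hc2.dvd
    rcases (Nat.dvd_prime hp.out).mp h2 with h3 | h3
    · exact hd (orderOf_eq_one_iff.mp h3)
    · rw [h3] at h1
      exact P.not_dvd_index h1
  have hker : χ.ker.index = p := by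
    have h1 : χ.ker.index ∣ p := by
      rw [index_ker]
      exact (card_subgroup_dvd_card χ.range).trans hc2.dvd
    rcases (Nat.dvd_prime hp.out).mp h1 with h3 | h3
    · rw [index_eq_one] at h3
      exact absurd (MonoidHom.mem_ker.mp (h3 ▸ mem_top (d : P))) hχd
    · exact h3
  exact hχd (MonoidHom.mem_ker.mp (hΦ _ hker d.2))

/-- The subgroup generated by the elements of order prime to `p`. -/
def pResidual (p : ℕ) (G : Type*) [Group G] : Subgroup G :=
  closure {g : G | ¬ p ∣ orderOf g}

instance pResidual_normal (p : ℕ) (G : Type*) [Group G] : (pResidual p G).Normal := by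
  refine ⟨fun n hn g => ?_⟩
  have h : (pResidual p G).map (MulAut.conj g).toMonoidHom ≤ pResidual p G := by
    rw [pResidual, MonoidHom.map_closure, closure_le]
    rintro _ ⟨x, hx, rfl⟩
    apply Subgroup.subset_closure
    change ¬ p ∣ orderOf (MulAut.conj g x)
    have h2 : orderOf (MulAut.conj g x) = orderOf x :=
      orderOf_injective (MulAut.conj g).toMonoidHom (MulAut.conj g).injective x
    rw [h2]
    exact hx
  exact h (mem_map_of_mem _ hn)

theorem eq_of_dvd_index_pResidual {G : Type*} [Group G] [Finite G] {p q : ℕ} (hp : p.Prime)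
    (hq : q.Prime) (h : q ∣ (pResidual p G).index) : q = p := by
  by_contra hne
  have : Fact q.Prime := ⟨hq⟩
  let Q : Sylow q G := default
  have hQ : (Q : Subgroup G) ≤ pResidual p G := by
    intro x hx
    apply Subgroup.subset_closure
    intro hpx
    obtain ⟨n, hn⟩ := Q.isPGroup'.exists_orderOf_eq_pow ⟨x, hx⟩
    rw [Subgroup.orderOf_mk] at hn
    rw [hn] at hpx
    exact hne ((Nat.prime_dvd_prime_iff_eq hp hq).mp (hp.dvd_of_dvd_pow hpx)).symm
  exact Q.not_dvd_index (h.trans (index_dvd_of_le hQ))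

theorem pResidual_hom {G : Type*} [Group G] {p : ℕ} (hp : p.Prime) {A : Type*} [Group A]
    (hA : Nat.card A = p) (f : pResidual p G →* A) : f = 1 := by
  have h : pResidual p G ≤ f.ker.map (pResidual p G).subtype := by
    conv_lhs => rw [pResidual]
    rw [closure_le]
    intro g hg
    have hgK : g ∈ pResidual p G := Subgroup.subset_closure hg
    refine ⟨⟨g, hgK⟩, ?_, rfl⟩
    have h1 : orderOf (f ⟨g, hgK⟩) ∣ p := (_root_.orderOf_dvd_natCard _).trans hA.dvd
    have h2 : orderOf (f ⟨g, hgK⟩) ∣ orderOf g := by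
      have := orderOf_map_dvd f ⟨g, hgK⟩
      rwa [Subgroup.orderOf_mk] at this
    rcases (Nat.dvd_prime hp).mp h1 with h3 | h3
    · exact orderOf_eq_one_iff.mp h3
    · exact absurd (h3 ▸ h2) hg
  ext k
  obtain ⟨k', hk', hkk⟩ := h k.2
  rw [← Subtype.ext hkk]
  exact hk'

theorem Good.exists_complement {G : Type*} [Group G] [Finite G] (hG : Good G) (p : ℕ)
    (hp : p.Prime) (hpm : p = (Nat.card G).minFac) :
    ∃ K : Subgroup G, K.Normal ∧ ¬ p ∣ Nat.card K ∧ ∀ q : ℕ, q.Prime → q ∣ K.index → q = p := by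
  have : Fact p.Prime := ⟨hp⟩
  let P : Sylow p G := default
  by_cases hc : IsCyclic P
  · have h := hc.isComplement' hpm.symm
    refine ⟨(MonoidHom.transferSylow P (hc.normalizer_le_centralizer hpm.symm)).ker, inferInstance,
      MonoidHom.not_dvd_card_ker_transferSylow P _, ?_⟩
    intro q hq hqd
    rw [h.symm.index_eq_card] at hqd
    obtain ⟨n, hn⟩ := IsPGroup.iff_card.mp P.isPGroup'
    rw [hn] at hqd
    exact (Nat.prime_dvd_prime_iff_eq hq hp).mp (hq.dvd_of_dvd_pow hqd)
  · refine ⟨pResidual p G, inferInstance, ?_, fun q hq h => eq_of_dvd_index_pResidual hp hq h⟩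
    have hsup : (P : Subgroup G) ⊔ pResidual p G = ⊤ := by
      rw [← index_eq_one]
      by_contra hne
      obtain ⟨q, hq, hqd⟩ := Nat.exists_prime_and_dvd hne
      have h1 := eq_of_dvd_index_pResidual hp hq (hqd.trans (index_dvd_of_le le_sup_right))
      subst h1
      exact P.not_dvd_index (hqd.trans (index_dvd_of_le le_sup_left))
    have hc2 : Nat.card (Multiplicative (ZMod p)) = p := by
      rw [Nat.card_congr Multiplicative.toAdd, Nat.card_zmod]
    have hbot := tate_s9 P (pResidual p G) hsup (fun f => pResidual_hom hp hc2 f) (by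
      intro Q hQ
      obtain ⟨T, hQT, hT⟩ := hG p P hc (Q.map (P : Subgroup G).subtype) (map_subtype_le Q) (by
        rw [relIndex, ← comap_subtype, comap_map_eq_self_of_injective (subtype_injective _), hQ])
      have hTn : T.Normal := normal_of_index_eq_minFac_card (hT.trans hpm)
      have hKT : pResidual p G ≤ T := by
        intro x hx
        have h1 := DFunLike.congr_fun (pResidual_hom hp (A := G ⧸ T) hT
          ((QuotientGroup.mk' T).comp (pResidual p G).subtype)) ⟨x, hx⟩
        exact (QuotientGroup.eq_one_iff x).mp h1
      have hQT' : Q ≤ T.subgroupOf P := fun x hx => hQT (mem_map_of_mem _ hx)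
      have hTP : (T.subgroupOf P) ≤ Q := by
        have h1 := relIndex_mul_index hQT'
        rw [hQ] at h1
        have h2 : (T.subgroupOf (P : Subgroup G)).index ∣ p := Dvd.intro_left _ h1
        rcases (Nat.dvd_prime hp).mp h2 with h3 | h3
        · exfalso
          have h4 : (P : Subgroup G) ≤ T := relIndex_eq_one.mp h3
          exact P.not_dvd_index (hT.symm.dvd.trans (index_dvd_of_le h4))
        · rw [h3] at h1
          exact relIndex_eq_one.mp (Nat.eq_of_mul_eq_mul_right hp.pos (h1.trans (one_mul p).symm))
      exact le_trans (fun x hx => hKT hx) hTP)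
    intro hpd
    have h1 : (P : Subgroup G).relIndex (pResidual p G) ∣ (P : Subgroup G).index :=
      relIndex_dvd_index_of_normal' _ _
    have h2 : (P : Subgroup G) ⊓ pResidual p G = ⊥ := by
      rw [subgroupOf_eq_bot, disjoint_iff] at hbot
      rw [inf_comm]; exact hbot
    rw [← inf_relIndex_right, h2, relIndex_bot_left] at h1
    exact P.not_dvd_index (hpd.trans h1)

theorem Good.exists_normal_sylow (n : ℕ) : ∀ (G : Type*) [Group G] [Finite G], Nat.card G = n →
    Good G → Nontrivial G →
    ∃ (p : ℕ) (_ : Fact p.Prime) (P : Sylow p G), (P : Subgroup G).Normal ∧ (P : Subgroup G) ≠ ⊥ := by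
  induction n using Nat.strong_induction_on with
  | _ n ih =>
    intro G _ _ hn hG hnt
    have h1 : Nat.card G ≠ 1 := Finite.one_lt_card.ne'
    have hp := Nat.minFac_prime h1
    obtain ⟨K, hKn, hpK, hKi⟩ := hG.exists_complement _ hp rfl
    set p := (Nat.card G).minFac with hpdef
    have hpG : p ∣ Nat.card G := Nat.minFac_dvd _
    have hfp : Fact p.Prime := ⟨hp⟩
    by_cases hK : K = ⊥
    · -- G is a p-group
      subst hK
      have hpg : IsPGroup p (⊤ : Subgroup G) := by
        rw [IsPGroup.iff_card]
        refine ⟨(Nat.card G).primeFactorsList.length, ?_⟩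
        rw [card_top]
        rw [index_bot] at hKi
        exact Nat.eq_prime_pow_of_unique_prime_dvd Nat.card_pos.ne' (fun {d} hd hdd => hKi d hd hdd)
      refine ⟨p, hfp, hpg.toSylow (by rw [index_top]; exact hp.one_lt.ne' ∘ Nat.dvd_one.mp), ?_, ?_⟩
      · change (⊤ : Subgroup G).Normal
        infer_instance
      · change (⊤ : Subgroup G) ≠ ⊥
        exact top_ne_bot
    · have hKnt : Nontrivial K := (nontrivial_iff_ne_bot K).mpr hK
      have hcop : (Nat.card K).Coprime K.index := by
        apply Nat.coprime_of_dvd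
        intro q hq h1 h2
        exact hpK (hKi q hq h2 ▸ h1)
      have hlt : Nat.card K < n := by
        rw [← hn]
        refine lt_of_le_of_ne (Nat.le_of_dvd Nat.card_pos (card_subgroup_dvd_card K)) ?_
        intro h
        exact hpK (h ▸ hpG)
      obtain ⟨q, hq, Q, hQn, hQb⟩ := ih _ hlt K rfl (hG.normal K hcop) hKnt
      have hqQ : q ∣ Nat.card Q := by
        have := (Subgroup.nontrivial_iff_ne_bot _).mpr hQb
        obtain ⟨n, hn0, hn⟩ := Q.isPGroup'.nontrivial_iff_card.mp this
        rw [hn]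
        exact dvd_pow_self q hn0.ne'
      have hqi : ¬ q ∣ K.index := fun h => hpK (by
        rw [← hKi q hq.out h]
        exact hqQ.trans (card_subgroup_dvd_card _))
      have hpg : IsPGroup q ((Q : Subgroup K).map K.subtype) := Q.isPGroup'.map _
      refine ⟨q, hq, hpg.toSylow (by
        rw [index_map_subtype, hq.out.dvd_mul]
        exact not_or.mpr ⟨Q.not_dvd_index, hqi⟩), ?_, ?_⟩
      · change ((Q : Subgroup K).map K.subtype).Normal
        have := Q.characteristic_of_normal hQn
        infer_instance
      · change ((Q : Subgroup K).map K.subtype) ≠ ⊥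
        rw [Ne, map_eq_bot_iff_of_injective _ K.subtype_injective]
        exact hQb
/-- Automorphisms acting trivially modulo every subgroup of index `p` form a `p`-group. -/
theorem isPGroup_of_trivial_mod {P : Type*} [Group P] [Finite P] {p : ℕ} [hp : Fact p.Prime]
    (hP : IsPGroup p P) (B : Subgroup (MulAut P))
    (hB : ∀ α ∈ B, ∀ Q : Subgroup P, Q.index = p → ∀ y : P, y⁻¹ * α y ∈ Q) : IsPGroup p B := by
  have : Finite (MulAut P) :=
    Finite.of_injective (fun f : MulAut P => (f : P → P)) DFunLike.coe_injective
  rw [IsPGroup.iff_card]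
  refine ⟨(Nat.card B).primeFactorsList.length, ?_⟩
  refine Nat.eq_prime_pow_of_unique_prime_dvd Nat.card_pos.ne' (fun {q} hq hqd => ?_)
  by_contra hne
  have : Fact q.Prime := ⟨hq⟩
  obtain ⟨α, hα⟩ := exists_prime_orderOf_dvd_card' q hqd
  have hα1 : (α : MulAut P) ≠ 1 := by
    intro h
    have h2 : α = 1 := Subtype.ext h
    rw [h2, orderOf_one] at hα
    exact hq.one_lt.ne hα
  let F : Subgroup P := MonoidHom.eqLocus (α : MulAut P).toMonoidHom (MonoidHom.id P)
  have hF : F ≠ ⊤ := by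
    intro h
    apply hα1
    ext y
    have : y ∈ F := h ▸ mem_top y
    exact this
  obtain ⟨Q, hFQ, hQ⟩ := exists_index_prime hP F hF
  have hQtop : Q = ⊤ := by
    rw [eq_top_iff]
    intro y _
    let act : MulAction (zpowers α) {z : P // y⁻¹ * z ∈ Q} :=
      { smul := fun β z => ⟨((β : B) : MulAut P) z.1, by
          have h1 := Q.mul_mem z.2 (hB _ (β : B).2 Q hQ z.1)
          simpa [mul_assoc] using h1⟩
        one_smul := fun z => rfl
        mul_smul := fun β γ z => rfl }
    have hpg : IsPGroup q (zpowers α) := by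
      rw [IsPGroup.iff_card]
      exact ⟨1, by rw [Nat.card_zpowers, hα, pow_one]⟩
    have hcard : Nat.card {z : P // y⁻¹ * z ∈ Q} = Nat.card Q :=
      Nat.card_congr ((Equiv.mulLeft y⁻¹).subtypeEquiv (fun z => Iff.rfl))
    have hnd : ¬ q ∣ Nat.card {z : P // y⁻¹ * z ∈ Q} := by
      rw [hcard]
      intro h
      obtain ⟨n, hn⟩ := IsPGroup.iff_card.mp (hP.to_subgroup Q)
      rw [hn] at h
      exact hne ((Nat.prime_dvd_prime_iff_eq hq hp.out).mp (hq.dvd_of_dvd_pow h))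
    obtain ⟨z, hz⟩ := hpg.nonempty_fixed_point_of_prime_not_dvd_card _ hnd
    have hzF : z.1 ∈ F := congrArg Subtype.val (hz ⟨α, mem_zpowers α⟩)
    have := Q.mul_mem (hFQ hzF) (Q.inv_mem z.2)
    simpa using this
  rw [hQtop, index_top] at hQ
  exact hp.out.one_lt.ne hQ

theorem exists_hom_units {G : Type*} [Group G] [Finite G] {p : ℕ} [hp : Fact p.Prime]
    (A : Subgroup G) [A.Normal] (hA : Nat.card A = p) :
    ∃ h : G →* (ZMod p)ˣ, ∀ z, h z = 1 → ∀ a ∈ A, z * a * z⁻¹ = a := by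
  have hc : IsCyclic A := isCyclic_of_prime_card hA
  subst hA
  refine ⟨(IsCyclic.mulAutMulEquiv A).toMonoidHom.comp MulAut.conjNormal, ?_⟩
  intro z hz a ha
  have h1 : (MulAut.conjNormal z : MulAut A) = 1 := by
    rw [← map_eq_one_iff (IsCyclic.mulAutMulEquiv A) (IsCyclic.mulAutMulEquiv A).injective]
    exact hz
  have h2 := DFunLike.congr_fun h1 ⟨a, ha⟩
  exact congrArg Subtype.val h2

/-- Elements killed by all homomorphisms to `(ZMod p)ˣ`. -/
def unitRes (p : ℕ) (G : Type*) [Group G] : Subgroup G := ⨅ h : G →* (ZMod p)ˣ, h.ker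

theorem mem_unitRes {p : ℕ} {G : Type*} [Group G] {z : G} :
    z ∈ unitRes p G ↔ ∀ h : G →* (ZMod p)ˣ, h z = 1 := by
  simp [unitRes, mem_iInf, MonoidHom.mem_ker]

instance unitRes_normal (p : ℕ) (G : Type*) [Group G] : (unitRes p G).Normal := by
  refine ⟨fun n hn g => ?_⟩
  rw [mem_unitRes] at hn ⊢
  intro h
  simp [hn h]

theorem pow_mem_unitRes {p : ℕ} [hp : Fact p.Prime] {G : Type*} [Group G] (x : G) :
    x ^ (p - 1) ∈ unitRes p G := by
  rw [mem_unitRes]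
  intro h
  rw [map_pow]
  exact ZMod.units_pow_card_sub_one_eq_one p (h x)

theorem comm_mem_unitRes {p : ℕ} {G : Type*} [Group G] (x y : G) :
    x * y * x⁻¹ * y⁻¹ ∈ unitRes p G := by
  rw [mem_unitRes]
  intro h
  simp [mul_comm (h x) (h y)]

theorem le_unitRes {p : ℕ} [hp : Fact p.Prime] {G : Type*} [Group G] [Finite G] (P : Subgroup G)
    (hP : IsPGroup p P) : P ≤ unitRes p G := by
  intro x hx
  rw [mem_unitRes]
  intro h
  obtain ⟨n, hn⟩ := hP.exists_orderOf_eq_pow ⟨x, hx⟩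
  rw [Subgroup.orderOf_mk] at hn
  have h1 : orderOf (h x) ∣ p ^ n := hn ▸ orderOf_map_dvd h x
  have h2 : orderOf (h x) ∣ p - 1 :=
    orderOf_dvd_of_pow_eq_one (ZMod.units_pow_card_sub_one_eq_one p (h x))
  have h3 : (p ^ n).Coprime (p - 1) := by
    apply Nat.Coprime.pow_left
    rw [hp.out.coprime_iff_not_dvd]
    intro h4
    have := Nat.le_of_dvd (by have := hp.out.one_lt; omega) h4
    have := hp.out.one_lt
    omega
  exact orderOf_eq_one_iff.mp (Nat.eq_one_of_dvd_coprimes h3 h1 h2)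

/-- Every index `p` subgroup of a noncyclic normal Sylow subgroup is normal. -/
theorem Good.normal_of_relIndex {G : Type*} [Group G] [Finite G] (hG : Good G) {p : ℕ}
    [hp : Fact p.Prime] (P : Sylow p G) [(P : Subgroup G).Normal] (hc : ¬ IsCyclic P)
    (Q : Subgroup G) (hQP : Q ≤ P) (hQ : Q.relIndex P = p) : Q.Normal := by
  obtain ⟨T, hQT, hT⟩ := hG p P hc Q hQP hQ
  have hnle : ¬ (P : Subgroup G) ≤ T := fun h =>
    P.not_dvd_index (hT.symm.dvd.trans (index_dvd_of_le h))
  have hinf : T ⊓ P = Q := by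
    apply le_antisymm _ (le_inf hQT hQP)
    have h1 := relIndex_mul_relIndex Q (T ⊓ P) P (le_inf hQT hQP) inf_le_right
    rw [hQ, inf_relIndex_right] at h1
    rcases (Nat.dvd_prime hp.out).mp (Dvd.intro_left _ h1) with h3 | h3
    · exact absurd (relIndex_eq_one.mp h3) hnle
    · rw [h3] at h1
      exact relIndex_eq_one.mp (Nat.eq_of_mul_eq_mul_right hp.out.pos (h1.trans (one_mul p).symm))
  have hQn : (Q.subgroupOf P).Normal := normal_of_index_prime P.isPGroup' _ hQ
  have hsup : T ⊔ P = ⊤ := by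
    rw [← index_eq_one]
    have h1 := relIndex_mul_index (show T ≤ T ⊔ P from le_sup_left)
    rw [hT] at h1
    rcases (Nat.dvd_prime hp.out).mp (Dvd.intro_left _ h1) with h3 | h3
    · exact h3
    · exact absurd (h3.symm.dvd.trans (index_dvd_of_le le_sup_right)) P.not_dvd_index
  rw [← normalizer_eq_top_iff, eq_top_iff, ← hsup, sup_le_iff]
  constructor
  · rw [le_normalizer_iff]
    intro t ht k hk
    rw [← hinf] at hk ⊢
    exact ⟨T.mul_mem (T.mul_mem ht hk.1) (T.inv_mem ht),
      (inferInstance : (P : Subgroup G).Normal).conj_mem k hk.2 t⟩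
  · exact (normal_subgroupOf_iff_le_normalizer hQP).mp hQn
theorem Good.unitRes_act {G : Type*} [Group G] [Finite G] (hG : Good G) {p : ℕ}
    [hp : Fact p.Prime] (P : Sylow p G) [(P : Subgroup G).Normal] (hc : ¬ IsCyclic P) :
    IsPGroup p ((unitRes p G).map (MulAut.conjNormal (H := (P : Subgroup G)))) := by
  apply isPGroup_of_trivial_mod P.isPGroup'
  rintro _ ⟨z, hz, rfl⟩ Q hQ y
  have hQr : (Q.map (P : Subgroup G).subtype).relIndex P = p := by
    rw [relIndex, ← comap_subtype, comap_map_eq_self_of_injective (subtype_injective _), hQ]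
  have hQn := hG.normal_of_relIndex P hc (Q.map (P : Subgroup G).subtype) (map_subtype_le Q) hQr
  set R := Q.map (P : Subgroup G).subtype with hR
  have hcard : Nat.card ((P : Subgroup G).map (QuotientGroup.mk' R)) = p := by
    rw [← relIndex_ker, QuotientGroup.ker_mk']
    exact hQr
  have hAn : ((P : Subgroup G).map (QuotientGroup.mk' R)).Normal :=
    Normal.map inferInstance _ (QuotientGroup.mk'_surjective R)
  obtain ⟨h, hh⟩ := exists_hom_units ((P : Subgroup G).map (QuotientGroup.mk' R)) hcard
  have h1 := hh (QuotientGroup.mk' R z) (mem_unitRes.mp hz (h.comp (QuotientGroup.mk' R)))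
    (QuotientGroup.mk' R y) (mem_map_of_mem _ y.2)
  rw [← map_mul, ← map_inv, ← map_mul] at h1
  have h2 : (y : G)⁻¹ * (z * y * z⁻¹) ∈ R := QuotientGroup.eq.mp h1.symm
  obtain ⟨w, hw, hw2⟩ := h2
  have : w = y⁻¹ * MulAut.conjNormal (H := (P : Subgroup G)) z y := Subtype.ext hw2
  rw [← this]
  exact hw

/-- A linear map with `f ^ (p - 1) = 1` on a nonzero `ZMod p`-space has an eigenvector. -/
theorem exists_eigen_aux {A : Type*} [AddCommGroup A] [Finite A] [Nontrivial A] {p : ℕ}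
    [hp : Fact p.Prime] [Module (ZMod p) A] (F : Module.End (ZMod p) A)
    (hf : ∀ a, F^[p - 1] a = a) : ∃ (n : ℕ) (a : A), a ≠ 0 ∧ F a = n • a := by
  have hF : F ^ (p - 1) = LinearMap.id := by
    ext a
    rw [Module.End.pow_apply]
    exact hf a
  have hF1 : F ^ p = F := by
    have h1 : ∀ m : ℕ, m = p - 1 + 1 → F ^ m = F := by
      intro m hm
      rw [hm, pow_succ, hF]
      rfl
    exact h1 p (Nat.sub_add_cancel hp.out.one_le).symm
  have hfin : Module.Finite (ZMod p) A := Module.Finite.of_finite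
  have hFp : Polynomial.aeval F (Polynomial.X ^ p - Polynomial.X : Polynomial (ZMod p)) = 0 := by
    rw [map_sub, map_pow, Polynomial.aeval_X, hF1, sub_self]
  have hspl : (Polynomial.X ^ p - Polynomial.X : Polynomial (ZMod p)).Splits := by
    have := FiniteField.splits_X_pow_card_sub_X (K := ZMod p) p
    rwa [ZMod.card, Algebra.algebraMap_self, Polynomial.map_id] at this
  have hint : IsIntegral (ZMod p) F := Algebra.IsIntegral.isIntegral F
  have hms : (minpoly (ZMod p) F).Splits :=
    hspl.of_dvd (FiniteField.X_pow_card_sub_X_ne_zero (ZMod p) hp.out.one_lt) (minpoly.dvd _ _ hFp)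
  obtain ⟨μ, hμ⟩ := hms.exists_eval_eq_zero (minpoly.degree_pos hint).ne'
  have hev := Module.End.hasEigenvalue_of_isRoot (f := F) (μ := μ) hμ
  obtain ⟨a, ha⟩ := hev.exists_hasEigenvector
  refine ⟨μ.val, a, ha.2, ?_⟩
  have h1 : F a = μ • a := ha.apply_eq_smul
  rw [h1, ← Nat.cast_smul_eq_nsmul (ZMod p), ZMod.natCast_zmod_val]

theorem exists_eigen_s9 {A : Type*} [AddCommGroup A] [Finite A] [Nontrivial A] {p : ℕ}
    [hp : Fact p.Prime] (hA : ∀ a : A, p • a = 0) (f : A →+ A)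
    (hf : ∀ a, f^[p - 1] a = a) : ∃ (n : ℕ) (a : A), a ≠ 0 ∧ f a = n • a := by
  let inst : Module (ZMod p) A := AddCommGroup.zmodModule hA
  exact exists_eigen_aux (f.toZModLinearMap p) hf

theorem Good.exists_normal_zpowers {G : Type*} [Group G] [Finite G] (hG : Good G) {p : ℕ}
    [hp : Fact p.Prime] (P : Sylow p G) [(P : Subgroup G).Normal] (hPb : (P : Subgroup G) ≠ ⊥)
    (hc : ¬ IsCyclic P) : ∃ v : G, v ≠ 1 ∧ (zpowers v).Normal := by
  obtain ⟨N, ⟨hNn, hNb, hNP⟩, hmin⟩ : ∃ N : Subgroup G, (N.Normal ∧ N ≠ ⊥ ∧ N ≤ P) ∧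
      ∀ M : Subgroup G, M.Normal → M ≠ ⊥ → M ≤ N → M = N := by
    obtain ⟨N, hN⟩ := Set.Finite.exists_minimal
      (Set.toFinite {N : Subgroup G | N.Normal ∧ N ≠ ⊥ ∧ N ≤ P}) ⟨P, inferInstance, hPb, le_rfl⟩
    exact ⟨N, hN.prop, fun M h1 h2 h3 => hN.eq_of_le ⟨h1, h2, h3.trans hN.prop.2.2⟩ h3⟩
  have hNp : IsPGroup p N := P.isPGroup'.to_le hNP
  have hNnt : Nontrivial N := (nontrivial_iff_ne_bot N).mpr hNb
  have hpN : p ∣ Nat.card N := by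
    obtain ⟨n, hn0, hn⟩ := hNp.nontrivial_iff_card.mp hNnt
    rw [hn]
    exact dvd_pow_self p hn0.ne'
  have hpact : IsPGroup p ((unitRes p G).map (MulAut.conjNormal (H := N))) := by
    rintro ⟨_, z, hz, rfl⟩
    obtain ⟨k, hk⟩ := hG.unitRes_act P hc ⟨_, mem_map_of_mem _ hz⟩
    refine ⟨k, ?_⟩
    apply Subtype.ext
    have hk' : MulAut.conjNormal (H := (P : Subgroup G)) z ^ p ^ k = 1 := congrArg Subtype.val hk
    change MulAut.conjNormal (H := N) z ^ p ^ k = 1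
    rw [← map_pow] at hk' ⊢
    ext v
    have := DFunLike.congr_fun hk' ⟨v, hNP v.2⟩
    exact congrArg (fun w : (P : Subgroup G) => (w : G)) this
  have hcent : ∀ z ∈ unitRes p G, ∀ v ∈ N, z * v = v * z := by
    have h1 : (1 : N) ∈ MulAction.fixedPoints
        ((unitRes p G).map (MulAut.conjNormal (H := N))) N := by
      intro a
      exact map_one (a : MulAut N)
    obtain ⟨v, hv, hv1⟩ := hpact.exists_fixed_point_of_prime_dvd_card_of_fixed_point _ hpN h1
    have hM : N ⊓ centralizer (unitRes p G : Set G) = N := by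
      apply hmin _ inferInstance _ inf_le_left
      intro hb
      have hvm : (v : G) ∈ N ⊓ centralizer (unitRes p G : Set G) := by
        refine ⟨v.2, ?_⟩
        refine mem_centralizer_iff.mpr ?_
        intro z hz
        have h2 := hv ⟨_, mem_map_of_mem _ hz⟩
        have h3 : z * v * z⁻¹ = v := congrArg Subtype.val h2
        exact mul_inv_eq_iff_eq_mul.mp h3
      rw [hb, mem_bot] at hvm
      exact hv1 (Subtype.ext hvm.symm)
    intro z hz v hv
    rw [← hM] at hv
    exact mem_centralizer_iff.mp hv.2 z hz
  have hPL : (P : Subgroup G) ≤ unitRes p G := le_unitRes _ P.isPGroup'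
  have hab : ∀ a ∈ N, ∀ b ∈ N, a * b = b * a := fun a ha b hb => hcent a (hPL (hNP ha)) b hb
  -- exponent p
  have hexp : ∀ v ∈ N, v ^ p = 1 := by
    let M : Subgroup G :=
      { carrier := {v | v ∈ N ∧ v ^ p = 1}
        mul_mem' := fun {a b} ha hb => ⟨N.mul_mem ha.1 hb.1, by
          rw [(show Commute a b from hab a ha.1 b hb.1).mul_pow, ha.2, hb.2, one_mul]⟩
        one_mem' := ⟨N.one_mem, one_pow p⟩
        inv_mem' := fun {a} ha => ⟨N.inv_mem ha.1, by rw [inv_pow, ha.2, inv_one]⟩ }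
    have hM : M = N := by
      apply hmin M
      · refine ⟨fun v hv g => ⟨hNn.conj_mem v hv.1 g, ?_⟩⟩
        rw [conj_pow, hv.2, mul_one, mul_inv_cancel]
      · intro hb
        obtain ⟨v, hv⟩ := exists_prime_orderOf_dvd_card' p hpN
        have hvM : (v : G) ∈ M := ⟨v.2, by
          have := pow_orderOf_eq_one v
          rw [hv] at this
          exact congrArg Subtype.val this⟩
        rw [hb, mem_bot] at hvM
        have h2 : v = 1 := Subtype.ext hvM
        rw [h2, orderOf_one] at hv
        exact hp.out.one_lt.ne hv
      · exact fun v hv => hv.1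
    intro v hv
    rw [← hM] at hv
    exact hv.2
  -- every element acts as a power
  have hpow : ∀ x : G, ∃ n : ℕ, ∀ v ∈ N, x * v * x⁻¹ = v ^ n := by
    intro x
    let _ : CommGroup N := { (inferInstance : Group N) with
      mul_comm := fun a b => Subtype.ext (hab a a.2 b b.2) }
    obtain ⟨n, a, ha, hxa⟩ := exists_eigen_s9 (A := Additive N) (p := p)
      (fun a => by
        have : (Additive.toMul a) ^ p = 1 := Subtype.ext (hexp _ (Additive.toMul a).2)
        exact congrArg Additive.ofMul this)
      (MonoidHom.toAdditive (MulAut.conjNormal (H := N) x).toMonoidHom) (by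
        intro a
        have h1 : ∀ (m : ℕ) (v : N), (MulAut.conjNormal (H := N) x)^[m] v =
            MulAut.conjNormal (H := N) (x ^ m) v := by
          intro m
          induction m with
          | zero => intro v; simp
          | succ m ih =>
            intro v
            rw [Function.iterate_succ_apply', ih, pow_succ', map_mul]
            rfl
        have h2 := h1 (p - 1) (Additive.toMul a)
        have h3 : MulAut.conjNormal (H := N) (x ^ (p - 1)) (Additive.toMul a) =
            Additive.toMul a := by
          apply Subtype.ext
          rw [MulAut.conjNormal_apply, hcent _ (pow_mem_unitRes x) _ (Additive.toMul a).2,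
            mul_inv_cancel_right]
        exact h2.trans h3)
    have hxa' : x * (Additive.toMul a : N) * x⁻¹ = ((Additive.toMul a : N) : G) ^ n :=
      congrArg (fun b : Additive N => ((Additive.toMul b : N) : G)) hxa
    let M : Subgroup G :=
      { carrier := {v | v ∈ N ∧ x * v * x⁻¹ = v ^ n}
        mul_mem' := fun {a b} ha hb => ⟨N.mul_mem ha.1 hb.1, by
          rw [(show Commute a b from hab a ha.1 b hb.1).mul_pow, ← ha.2, ← hb.2]
          group⟩
        one_mem' := ⟨N.one_mem, by simp⟩
        inv_mem' := fun {a} ha => ⟨N.inv_mem ha.1, by rw [inv_pow, ← ha.2]; group⟩ }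
    have hM : M = N := by
      apply hmin M
      · refine ⟨fun v hv y => ⟨hNn.conj_mem v hv.1 y, ?_⟩⟩
        rw [conj_pow, ← hv.2]
        have h1 := hcent _ (comm_mem_unitRes x y) (y * (x * v * x⁻¹) * y⁻¹)
          (hNn.conj_mem _ (hNn.conj_mem v hv.1 x) y)
        have h2 := mul_inv_eq_iff_eq_mul.mpr h1
        rw [← h2]
        group
      · intro hb
        have : ((Additive.toMul a : N) : G) ∈ M := ⟨(Additive.toMul a : N).2, hxa'⟩
        rw [hb, mem_bot] at this
        apply ha
        have h2 : (Additive.toMul a : N) = 1 := Subtype.ext this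
        exact h2
      · exact fun v hv => hv.1
    refine ⟨n, fun v hv => ?_⟩
    rw [← hM] at hv
    exact hv.2
  obtain ⟨v, hv⟩ := exists_ne (1 : N)
  refine ⟨v, fun h => hv (Subtype.ext h), ⟨fun w hw g => ?_⟩⟩
  have hwN : w ∈ N := (zpowers_le.mpr v.2) hw
  obtain ⟨n, hn⟩ := hpow g
  rw [hn w hwN]
  exact pow_mem hw n

theorem Good.isSupersoluble (n : ℕ) : ∀ (G : Type*) [Group G] [Finite G], Nat.card G = n →
    Good G → IsSupersoluble G := by
  induction n using Nat.strong_induction_on with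
  | _ n ih =>
    intro G _ _ hn hG
    rcases subsingleton_or_nontrivial G with hs | hnt
    · refine ⟨0, fun _ => ⊥, rfl, Subsingleton.elim _ _, fun _ => inferInstance,
        fun k => k.elim0, fun k => k.elim0⟩
    · have key : ∀ v : G, v ≠ 1 → (zpowers v).Normal → IsSupersoluble G := by
        intro v hv hvn
        refine IsSupersoluble.of_quotient (zpowers v) ⟨v, rfl⟩ (ih _ ?_ (G ⧸ zpowers v) rfl
          (hG.quotient _))
        rw [← hn, ← card_mul_index (zpowers v)]
        have h1 : 1 < Nat.card (zpowers v) := by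
          rw [one_lt_card_iff_ne_bot]
          exact fun h => hv (zpowers_eq_bot.mp h)
        have h2 : 0 < (zpowers v).index := Nat.pos_of_ne_zero index_ne_zero_of_finite
        change (zpowers v).index < _
        exact lt_mul_of_one_lt_left h2 h1
      obtain ⟨p, hp, P, hPn, hPb⟩ := Good.exists_normal_sylow _ G rfl hG hnt
      by_cases hc : IsCyclic P
      · obtain ⟨v, hv⟩ := isCyclic_iff_exists_zpowers_eq_top.mp hc
        have hvP : zpowers (v : G) = P := by
          have h1 : (zpowers v).map (P : Subgroup G).subtype = zpowers (v : G) :=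
            MonoidHom.map_zpowers _ _
          rw [← h1, hv, ← MonoidHom.range_eq_map, range_subtype]
        apply key (v : G)
        · intro h
          rw [h, zpowers_one_eq_bot] at hvP
          exact hPb hvP.symm
        · rw [hvP]
          exact hPn
      · obtain ⟨v, hv, hvn⟩ := hG.exists_normal_zpowers P hPb hc
        exact key v hv hvn
theorem isCoatom_of_index_prime' {L : Type*} [Group L] [Finite L] {p : ℕ} (hp : p.Prime)
    (M : Subgroup L) (hM : M.index = p) : IsCoatom M := by
  refine ⟨fun h => ?_, fun K hK => ?_⟩
  · rw [h, index_top] at hM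
    exact hp.one_lt.ne hM
  · have h1 := relIndex_mul_index hK.le
    rw [hM] at h1
    rcases (Nat.dvd_prime hp).mp (Dvd.intro_left _ h1) with h2 | h2
    · exact index_eq_one.mp h2
    · rw [h2] at h1
      exact absurd (relIndex_eq_one.mp
        (Nat.eq_of_mul_eq_mul_right hp.pos (h1.trans (one_mul p).symm))) hK.not_ge

/-- In a finite nilpotent group, an index `p` subgroup of a Sylow `p`-subgroup lies in a subgroup
of index `p`. -/
theorem exists_index_prime_of_nilpotent {L : Type*} [Group L] [Finite L] [Group.IsNilpotent L]
    {p : ℕ} [hp : Fact p.Prime] (P : Sylow p L) (Q : Subgroup L) (hQP : Q ≤ P)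
    (hQ : Q.relIndex P = p) : ∃ M : Subgroup L, Q ≤ M ∧ M.index = p := by
  have hQi : Q.index = p * (P : Subgroup L).index := by
    have h1 := relIndex_mul_index hQP
    rw [← h1]
    exact congrArg (· * (P : Subgroup L).index) hQ
  obtain ⟨M, hM⟩ := Set.Finite.exists_maximal
    (Set.toFinite {M : Subgroup L | Q ≤ M ∧ p ∣ M.index}) ⟨Q, le_rfl, hQi ▸ dvd_mul_right _ _⟩
  refine ⟨M, hM.prop.1, ?_⟩
  have huniq : ∀ q : ℕ, q.Prime → q ∣ M.index → q = p := by
    intro q hq hqd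
    by_contra hne
    have : Fact q.Prime := ⟨hq⟩
    let W : Sylow q L := default
    have h1 : p ∣ (M ⊔ W).index := by
      have h2 := relIndex_mul_index (show M ≤ M ⊔ W from le_sup_left)
      rw [relIndex_sup_of_normal] at h2
      have h3 : p ∣ M.relIndex W * (M ⊔ W).index := h2 ▸ hM.prop.2
      refine (hp.out.dvd_mul.mp h3).resolve_left fun h4 => ?_
      have h5 := h4.trans (relIndex_dvd_card M W)
      obtain ⟨n, hn⟩ := IsPGroup.iff_card.mp W.isPGroup'
      have h6 : p ∣ q ^ n := hn ▸ h5
      exact hne ((Nat.prime_dvd_prime_iff_eq hp.out hq).mp (hp.out.dvd_of_dvd_pow h6)).symm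
    have h2 : M ⊔ W ≤ M := hM.le_of_ge ⟨hM.prop.1.trans le_sup_left, h1⟩ le_sup_left
    exact W.not_dvd_index (hqd.trans (index_dvd_of_le (le_sup_right.trans h2)))
  have h1 : M.index ∣ p * (P : Subgroup L).index := hQi ▸ index_dvd_of_le hM.prop.1
  have h2 : M.index.Coprime (P : Subgroup L).index := by
    apply Nat.coprime_of_dvd
    intro q hq h3 h4
    have h5 := huniq q hq h3
    rw [h5] at h4
    exact P.not_dvd_index h4
  exact Nat.dvd_antisymm (h2.dvd_of_dvd_mul_right h1) hM.prop.2

theorem relIndex_sup_of_permute {G : Type*} [Group G] (S B : Subgroup G)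
    (h : (S : Set G) * (B : Set G) = (B : Set G) * (S : Set G)) :
    S.relIndex (S ⊔ B) = S.relIndex B := by
  let T : Subgroup G :=
    { carrier := (B : Set G) * (S : Set G)
      mul_mem' := by
        rintro _ _ ⟨b, hb, s, hs, rfl⟩ ⟨b', hb', s', hs', rfl⟩
        have h1 : s * b' ∈ (B : Set G) * (S : Set G) := h ▸ Set.mul_mem_mul hs hb'
        obtain ⟨b2, hb2, s2, hs2, h2⟩ := h1
        refine ⟨b * b2, B.mul_mem hb hb2, s2 * s', S.mul_mem hs2 hs', ?_⟩
        have h3 : b2 * s2 = s * b' := h2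
        change b * b2 * (s2 * s') = b * s * (b' * s')
        calc b * b2 * (s2 * s') = b * (b2 * s2) * s' := by group
          _ = _ := by rw [h3]; group
      one_mem' := ⟨1, B.one_mem, 1, S.one_mem, mul_one 1⟩
      inv_mem' := by
        rintro _ ⟨b, hb, s, hs, rfl⟩
        change (b * s)⁻¹ ∈ (B : Set G) * (S : Set G)
        rw [← h, mul_inv_rev]
        exact Set.mul_mem_mul (S.inv_mem hs) (B.inv_mem hb) }
  have hT : S ⊔ B ≤ T := by
    rw [sup_le_iff]
    constructor
    · intro s hs
      exact ⟨1, B.one_mem, s, hs, one_mul s⟩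
    · intro b hb
      exact ⟨b, hb, 1, S.one_mem, mul_one b⟩
  symm
  refine Nat.card_congr (Equiv.ofBijective
    (quotientSubgroupOfEmbeddingOfLE S (show B ≤ S ⊔ B from le_sup_right))
    ⟨(quotientSubgroupOfEmbeddingOfLE S _).injective, ?_⟩)
  intro x
  induction x using QuotientGroup.induction_on with
  | H x =>
    obtain ⟨b, hb, s, hs, hbs⟩ := hT x.2
    refine ⟨QuotientGroup.mk ⟨b, hb⟩, ?_⟩
    rw [quotientSubgroupOfEmbeddingOfLE_apply_mk]
    rw [QuotientGroup.eq, mem_subgroupOf]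
    change b⁻¹ * (x : G) ∈ S
    rw [← hbs]
    simpa using hs

theorem good_of_exists {G : Type*} [Group G] [Finite G]
    (h : ∀ (p : ℕ) [Fact p.Prime], p ∣ Nat.card G → ∃ P : Sylow p G, ¬ IsCyclic P →
      ∀ Q : Subgroup G, Q ≤ P → Q.relIndex P = p → ∃ T : Subgroup G, Q ≤ T ∧ T.index = p) :
    Good G := by
  intro p hp P hc Q hQP hQ
  have hpd : p ∣ Nat.card G := by
    have h1 : Q.relIndex P ∣ Nat.card P := relIndex_dvd_card _ _
    exact hQ.symm.dvd.trans (h1.trans (card_subgroup_dvd_card _))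
  obtain ⟨P', hP'⟩ := h p hpd
  obtain ⟨g, rfl⟩ := MulAction.exists_smul_eq G P' P
  let α := (MulAut.conj g)
  have hmap : ((g • P' : Sylow p G) : Subgroup G) = (P' : Subgroup G).map α.toMonoidHom := rfl
  have hc' : ¬ IsCyclic P' := by
    intro hcy
    apply hc
    exact isCyclic_of_surjective _ (α.toMonoidHom.subgroupMap_surjective (P' : Subgroup G))
  obtain ⟨T, hQT, hT⟩ := hP' hc' (Q.comap α.toMonoidHom) (by
    intro x hx
    have h1 : α x ∈ (P' : Subgroup G).map α.toMonoidHom := hmap ▸ hQP hx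
    obtain ⟨y, hy, hyx⟩ := h1
    rw [← α.injective hyx]
    exact hy) (by rw [relIndex_comap]; exact hQ)
  refine ⟨T.map α.toMonoidHom, ?_, ?_⟩
  · rw [← map_comap_eq_self_of_surjective (f := α.toMonoidHom) α.surjective Q]
    exact map_mono hQT
  · rw [← hT]
    exact index_map_equiv T α

theorem good_of_hyp {G : Type*} [Group G] [Finite G] {I : Type*} (σ : I → Set ℕ)
    (hσ : IsPrimePartition σ)
    (t : ℕ) (idx : Fin t → I) (H : Fin t → Subgroup G)
    (hinj : Function.Injective idx)
    (hcomplete : ∀ i : I, SigmaMem σ G i ↔ ∃ k, idx k = i)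
    (hHall : ∀ k, IsHallSigmaIn (σ (idx k)) (H k) ⊤)
    (hnilp : ∀ k, Group.IsNilpotent (H k))
    (E : Subgroup G) [E.Normal]
    (hmax : ∀ k, SigmaMem σ E (idx k) → ¬ IsCyclic ↥(H k ⊓ E) →
      ∀ M : Subgroup ↥(H k ⊓ E), IsCoatom M →
        ∃ S : Subgroup G, IsSylowizerIn (σ (idx k)) ⊤ (M.map (H k ⊓ E).subtype) S ∧
          ∀ l, CPermutable S (H l)) : Good E := by
  obtain ⟨-, hprime, hcover, hdisj⟩ := hσ
  apply good_of_exists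
  intro p hp hpE
  obtain ⟨i, hi⟩ := hcover p hp.out
  obtain ⟨k, rfl⟩ := (hcomplete i).mp ⟨p, hi, hpE.trans (card_subgroup_dvd_card E)⟩
  have hEmem : SigmaMem σ E (idx k) := ⟨p, hi, hpE⟩
  have hmaxk := hmax k hEmem
  set L := H k ⊓ E with hL
  have hLE : L ≤ E := inf_le_right
  have hLnil : Group.IsNilpotent L := by
    have := hnilp k
    exact Subgroup.isNilpotent_of_ker_le_center (inclusion (inf_le_left : L ≤ H k))
      (by rw [(MonoidHom.ker_eq_bot_iff _).mpr (inclusion_injective _)]; exact bot_le)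
  have hLidx : ∀ q : ℕ, q.Prime → q ∈ σ (idx k) → ¬ q ∣ L.relIndex E := by
    intro q hq hqs hqd
    rw [hL, inf_relIndex_right] at hqd
    have h1 := (hHall k).2.2 q hq hqs
    rw [relIndex_top_right] at h1
    exact h1 (hqd.trans (relIndex_dvd_index_of_normal' _ _))
  let P0 : Sylow p L := default
  let e : L →* E := inclusion hLE
  have he : Function.Injective e := inclusion_injective hLE
  have hpg : IsPGroup p ((P0 : Subgroup L).map e) := P0.isPGroup'.map e
  have herange : e.range = L.subgroupOf E := inclusion_range hLE
  have hPidx : ¬ p ∣ ((P0 : Subgroup L).map e).index := by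
    rw [index_map_of_injective _ he, herange, hp.out.dvd_mul]
    exact not_or.mpr ⟨P0.not_dvd_index, hLidx p hp.out hi⟩
  refine ⟨hpg.toSylow hPidx, ?_⟩
  change ¬ IsCyclic ((P0 : Subgroup L).map e) → ∀ Q : Subgroup E, Q ≤ (P0 : Subgroup L).map e →
    Q.relIndex ((P0 : Subgroup L).map e) = p → _
  intro hc Q hQP hQ
  have hLc : ¬ IsCyclic L := by
    intro h
    apply hc
    exact isCyclic_of_surjective _ (e.subgroupMap_surjective (P0 : Subgroup L))
  obtain ⟨M, hQM, hM⟩ := exists_index_prime_of_nilpotent P0 (Q.comap e)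
    (by
      rw [← comap_map_eq_self_of_injective he (P0 : Subgroup L)]
      exact comap_mono hQP)
    (by rw [relIndex_comap]; exact hQ)
  obtain ⟨S, ⟨-, ⟨hRS, hRcard, hRidx⟩, hSmax⟩, hperm⟩ :=
    hmaxk hLc M (isCoatom_of_index_prime' hp.out M hM)
  set R := M.map L.subtype with hR
  have hRL : R ≤ L := map_subtype_le M
  -- the index of S is a σ-number
  have hSidx : ∀ q : ℕ, q.Prime → q ∣ S.index → q ∈ σ (idx k) := by
    intro q hq hqd
    obtain ⟨i', hi'⟩ := hcover q hq
    obtain ⟨l, rfl⟩ := (hcomplete i').mp ⟨q, hi', hqd.trans (index_dvd_card S)⟩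
    by_cases hlk : l = k
    · rw [← hlk]; exact hi'
    exfalso
    obtain ⟨x, hx⟩ := hperm l
    set B := conjSubgroup x⁻¹ (H l) with hB
    have hBcard : Nat.card B = Nat.card (H l) :=
      card_map_of_injective (MulAut.conj x⁻¹).injective
    have hBidx : B.index = (H l).index := index_map_equiv (H l) (MulAut.conj x⁻¹)
    have hsup : S ⊔ B = S := by
      apply hSmax _ le_top _ le_sup_left
      refine ⟨hRS.trans le_sup_left, hRcard, ?_⟩
      intro r hr hrs hrd
      rw [← relIndex_mul_relIndex R S (S ⊔ B) hRS le_sup_left, relIndex_sup_of_permute S B hx,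
        hr.dvd_mul] at hrd
      rcases hrd with hrd | hrd
      · exact hRidx r hr hrs hrd
      · have h1 := hrd.trans (relIndex_dvd_card S B)
        rw [hBcard] at h1
        have h2 := (hHall l).2.1 r hr h1
        exact Set.disjoint_left.mp (hdisj (idx l) (idx k) (fun h => hlk (hinj h))) h2 hrs
    have hBS : B ≤ S := hsup ▸ le_sup_right
    have h1 := hqd.trans (index_dvd_of_le hBS)
    rw [hBidx] at h1
    have h2 := (hHall l).2.2 q hq hi'
    rw [relIndex_top_right] at h2
    exact h2 h1
  refine ⟨S.subgroupOf E, ?_, ?_⟩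
  · intro y hy
    obtain ⟨x, -, rfl⟩ := hQP hy
    exact hRS ⟨x, hQM hy, rfl⟩
  · change S.relIndex E = p
    have hRSE : R ≤ S ⊓ E := le_inf hRS (hRL.trans hLE)
    have h1 := relIndex_mul_relIndex R (S ⊓ E) E hRSE inf_le_right
    have h2 := relIndex_mul_relIndex R L E hRL hLE
    have h3 : R.relIndex L = p := by
      rw [relIndex, ← comap_subtype, hR, comap_map_eq_self_of_injective (subtype_injective _), hM]
    have h4 : R.relIndex (S ⊓ E) ∣ R.relIndex S :=
      ⟨_, (relIndex_mul_relIndex R (S ⊓ E) S hRSE inf_le_left).symm⟩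
    rw [inf_relIndex_right] at h1
    rw [← h2, h3] at h1
    have h5 : S.relIndex E ∣ S.index := relIndex_dvd_index_of_normal' _ _
    have h6 : (S.relIndex E).Coprime (L.relIndex E) := by
      apply Nat.coprime_of_dvd
      intro q hq h7 h8
      exact hLidx q hq (hSidx q hq (h7.trans h5)) h8
    apply Nat.dvd_antisymm
    · exact h6.dvd_of_dvd_mul_right (Dvd.intro_left _ h1)
    · have h7 : p ∣ R.relIndex (S ⊓ E) * S.relIndex E := h1 ▸ dvd_mul_right _ _
      exact (hp.out.dvd_mul.mp h7).resolve_left fun h8 => hRidx p hp.out hi (h8.trans h4)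

end Helpers

/-- Let `G` be a `σ`-full group of Sylow type with a complete Hall `σ`-set
`{H 1, …, H t}` of nilpotent subgroups and `E ⊴ G`. If for every `σᵢ ∈ σ(E)` with
`H i ⊓ E` non-cyclic, every maximal subgroup of `H i ⊓ E` has a `σᵢ`-sylowizer in `G`
that is `c`-permutable with every member of the Hall `σ`-set, then `E` is supersoluble. -/
theorem stmt_9 {G : Type*} [Group G] [Finite G] {I : Type*} (σ : I → Set ℕ)
    (hσ : IsPrimePartition σ) (hfull : SigmaFullSylowType σ G)
    (t : ℕ) (idx : Fin t → I) (H : Fin t → Subgroup G)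
    (hinj : Function.Injective idx)
    (hcomplete : ∀ i : I, SigmaMem σ G i ↔ ∃ k, idx k = i)
    (hHall : ∀ k, IsHallSigmaIn (σ (idx k)) (H k) ⊤)
    (hnilp : ∀ k, Group.IsNilpotent (H k))
    (E : Subgroup G) [E.Normal]
    (hmax : ∀ k, SigmaMem σ E (idx k) → ¬ IsCyclic ↥(H k ⊓ E) →
      ∀ M : Subgroup ↥(H k ⊓ E), IsCoatom M →
        ∃ S : Subgroup G, IsSylowizerIn (σ (idx k)) ⊤ (M.map (H k ⊓ E).subtype) S ∧
          ∀ l, CPermutable S (H l)) :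
    IsSupersoluble E := by
  exact Good.isSupersoluble _ E rfl
    (good_of_hyp σ hσ t idx H hinj hcomplete hHall hnilp E hmax)
end

section
/- Let G be a finite group, σ_i a set of primes, E a normal subgroup of G, Q a σ_i-subgroup of E, and S a σ_i-sylowizer of Q in G such that the index |G : S| is a σ_i-number. Then S ∩ E is a σ_i-sylowizer of Q in E and the index |E : S ∩ E| is a σ_i-number. -/
open Pointwise

/-- If `E ⊴ G`, `Q` is a `σᵢ`-subgroup of `E`, and `S` is a `σᵢ`-sylowizer
of `Q` in `G` with `|G : S|` a `σᵢ`-number, then `S ∩ E` is a `σᵢ`-sylowizer of `Q` in `E`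
and `|E : S ∩ E|` is a `σᵢ`-number. -/
theorem stmt_11 {G : Type*} [Group G] [Finite G] (σi : Set ℕ) (E Q S : Subgroup G)
    [E.Normal] (hQE : Q ≤ E)
    (hQ : IsSigmaNumber σi (Nat.card Q))
    (hS : IsSylowizerIn σi ⊤ Q S)
    (hidx : IsSigmaNumber σi S.index) :
    IsSylowizerIn σi E Q (S ⊓ E) ∧ IsSigmaNumber σi ((S ⊓ E).relIndex E) := by
  have hdvd : (S ⊓ E).relIndex E ∣ S.index := by
    have h1 : (S ⊓ E).relIndex E * E.index = (S ⊓ E).index :=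
      Subgroup.relIndex_mul_index inf_le_right
    have h2 : (S ⊓ E).relIndex S * S.index = (S ⊓ E).index :=
      Subgroup.relIndex_mul_index inf_le_left
    have h3 : E.relIndex (S ⊔ E) * (S ⊔ E).index = E.index :=
      Subgroup.relIndex_mul_index le_sup_right
    have h4 : E.relIndex (S ⊔ E) = E.relIndex S := Subgroup.relIndex_sup_right S E
    have h5 : (S ⊓ E).relIndex S = E.relIndex S := Subgroup.inf_relIndex_left S E
    have h6 : 0 < E.relIndex S := Nat.pos_of_ne_zero Subgroup.index_ne_zero_of_finite
    refine ⟨(S ⊔ E).index, Nat.eq_of_mul_eq_mul_left h6 ?_⟩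
    rw [h5] at h2
    rw [h4] at h3
    rw [h2, ← h1, ← h3]
    ring
  have hidx' : IsSigmaNumber σi ((S ⊓ E).relIndex E) :=
    fun p hp hd => hidx p hp (hd.trans hdvd)
  obtain ⟨-, ⟨hQS, -, hHall⟩, -⟩ := hS
  have hQSE : Q ≤ S ⊓ E := le_inf hQS hQE
  refine ⟨⟨inf_le_right, ⟨hQSE, hQ, ?_⟩, ?_⟩, hidx'⟩
  · intro p hp hps hd
    exact hHall p hp hps (hd.trans ⟨_, (Subgroup.relIndex_mul_relIndex Q (S ⊓ E) S hQSE inf_le_left).symm⟩)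
  · rintro T hTE ⟨-, -, hT⟩ hle
    have hone : (S ⊓ E).relIndex T = 1 := by
      by_contra hne
      obtain ⟨p, hp, hpd⟩ := Nat.exists_prime_and_dvd hne
      have hps : p ∈ σi := hidx' p hp
        (hpd.trans ⟨_, (Subgroup.relIndex_mul_relIndex (S ⊓ E) T E hle hTE).symm⟩)
      exact hT p hp hps
        (hpd.trans ⟨_, ((mul_comm _ _).trans
          (Subgroup.relIndex_mul_relIndex Q (S ⊓ E) T hQSE hle)).symm⟩)
    exact le_antisymm (Subgroup.relIndex_eq_one.mp hone) hle
end

section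
/- Let G be a finite group, N a normal subgroup of G, and H, T subgroups of G. If H and T are c-permutable in G, then HN/N and TN/N are c-permutable in G/N. -/
open Pointwise

/-- If `H` and `T` are `c`-permutable in `G` and `N ⊴ G`, then `HN/N` and
`TN/N` are `c`-permutable in `G/N`. -/
theorem stmt_12 {G : Type*} [Group G] [Finite G] (N H T : Subgroup G) [N.Normal]
    (h : CPermutable H T) :
    CPermutable (H.map (QuotientGroup.mk' N)) (T.map (QuotientGroup.mk' N)) := by
  obtain ⟨x, hx⟩ := h
  refine ⟨QuotientGroup.mk' N x, ?_⟩
  have key : conjSubgroup (QuotientGroup.mk' N x)⁻¹ (T.map (QuotientGroup.mk' N))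
      = (conjSubgroup x⁻¹ T).map (QuotientGroup.mk' N) := by
    unfold conjSubgroup
    rw [Subgroup.map_map, Subgroup.map_map]
    congr 1
  rw [key, Subgroup.coe_map, Subgroup.coe_map, ← Set.image_mul, hx, Set.image_mul]
end
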